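/- arXiv:2410.10731 — 6 statements merged into one kernel-verified Lean document; each statement's English description precedes it below -/
import Mathlib

section
/- Let (T_j : X_j → Y_j)_{j=0}^∞ be a family of bounded linear maps between quasi-normed spaces with sup_j ‖T_j‖ < ∞ and 0 < limsup_{j→∞} ‖T_j‖_{X_j→Y_j}. Define T̂ by T̂((x_j)_j) = (T_j x_j)_j. Then for every q ∈ (0,∞], the induced map T̂ : ℓ^q((X_j)_j) → ℓ^q((Y_j)_j) is not strictly singular. -/
/-!
STATEMENT 0: Let (T_j : X_j → Y_j) be a family of bounded linear maps between
quasi-normed spaces with sup_j ‖T_j‖ < ∞ and 0 < limsup_j ‖T_j‖.  Then for every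
q ∈ (0,∞], the induced diagonal map T̂ : ℓ^q((X_j)_j) → ℓ^q((Y_j)_j) is not
strictly singular.
-/

open scoped ENNReal

namespace Stmt0

/-- A quasi-norm on a real vector space. -/
structure QuasiNorm (V : Type*) [AddCommGroup V] [Module ℝ V] where
  N : V → ℝ
  nonneg : ∀ v, 0 ≤ N v
  definite : ∀ v, N v = 0 ↔ v = 0
  norm_smul : ∀ (c : ℝ) (v : V), N (c • v) = |c| * N v
  C : ℝ
  one_le_C : 1 ≤ C
  quasi_triangle : ∀ v w, N (v + w) ≤ C * (N v + N w)

/-- The `ℓ^q`-norm of a family of extended-nonnegative numbers: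
`(∑ᵢ f i ^ q)^(1/q)` for `q < ∞`, and `⨆ᵢ f i` for `q = ∞`. -/
noncomputable def eSeqNorm {ι : Type*} (q : ℝ≥0∞) (f : ι → ℝ≥0∞) : ℝ≥0∞ :=
  if q = ∞ then ⨆ i, f i else (∑' i, f i ^ q.toReal) ^ (1 / q.toReal)

/-- The operator (quasi-)norm of a linear map, as sup over the unit sphere. -/
noncomputable def eOpNorm {V₀ V₁ : Type*} [AddCommGroup V₀] [Module ℝ V₀]
    [AddCommGroup V₁] [Module ℝ V₁]
    (M₀ : V₀ → ℝ≥0∞) (M₁ : V₁ → ℝ≥0∞) (T : V₀ →ₗ[ℝ] V₁) : ℝ≥0∞ :=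
  ⨆ x : {x : V₀ // M₀ x = 1}, M₁ (T x.1)

/-- `T` is strictly singular (w.r.t. the quasi-norms `M₀`, `M₁`): on every
infinite-dimensional subspace (of the space of elements of finite norm) the
infimum of `M₁ (T x)` over unit vectors `x` is `0`. -/
def StrictlySingular {V₀ V₁ : Type*} [AddCommGroup V₀] [Module ℝ V₀]
    [AddCommGroup V₁] [Module ℝ V₁]
    (M₀ : V₀ → ℝ≥0∞) (M₁ : V₁ → ℝ≥0∞) (T : V₀ →ₗ[ℝ] V₁) : Prop :=
  ∀ Z : Submodule ℝ V₀, (∀ x ∈ Z, M₀ x ≠ ∞) → ¬ FiniteDimensional ℝ Z →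
    ∀ ε : ℝ, 0 < ε → ∃ x ∈ Z, M₀ x = 1 ∧ M₁ (T x) < ENNReal.ofReal ε

theorem eSeqNorm_mono {ι : Type*} (q : ℝ≥0∞) {f g : ι → ℝ≥0∞} (h : ∀ i, f i ≤ g i) :
    eSeqNorm q f ≤ eSeqNorm q g := by
  unfold eSeqNorm
  split_ifs
  · exact iSup_mono h
  · exact ENNReal.rpow_le_rpow
      (ENNReal.tsum_le_tsum fun i => ENNReal.rpow_le_rpow (h i) ENNReal.toReal_nonneg)
      (by positivity)

theorem eSeqNorm_const_mul {ι : Type*} {q : ℝ≥0∞} (hq : 0 < q) (c : ℝ≥0∞) (f : ι → ℝ≥0∞) :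
    eSeqNorm q (fun i => c * f i) = c * eSeqNorm q f := by
  unfold eSeqNorm
  split_ifs with h
  · rw [ENNReal.mul_iSup]
  · have hr : 0 < q.toReal := ENNReal.toReal_pos hq.ne' h
    simp_rw [ENNReal.mul_rpow_of_nonneg _ _ hr.le, ENNReal.tsum_mul_left]
    rw [ENNReal.mul_rpow_of_nonneg _ _ (by positivity), ← ENNReal.rpow_mul,
      mul_one_div_cancel hr.ne', ENNReal.rpow_one]

theorem eSeqNorm_ne_top_of_finite_support {ι : Type*} {q : ℝ≥0∞} (hq : 0 < q)
    {f : ι → ℝ≥0∞} (hf : ∀ i, f i ≠ ∞) (s : Finset ι) (hs : ∀ i ∉ s, f i = 0) :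
    eSeqNorm q f ≠ ∞ := by
  unfold eSeqNorm
  split_ifs with h
  · refine ne_top_of_le_ne_top (ENNReal.sum_ne_top.2 fun i _ => hf i : ∑ i ∈ s, f i ≠ ∞)
      (iSup_le fun i => ?_)
    by_cases hi : i ∈ s
    · exact Finset.single_le_sum (fun _ _ => zero_le) hi
    · simp [hs i hi]
  · have hr : 0 < q.toReal := ENNReal.toReal_pos hq.ne' h
    rw [tsum_eq_sum fun i hi => by rw [hs i hi, ENNReal.zero_rpow_of_pos hr]]
    exact ENNReal.rpow_ne_top_of_nonneg (by positivity)
      (ENNReal.sum_ne_top.2 fun i _ => ENNReal.rpow_ne_top_of_nonneg hr.le (hf i))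

open Classical in
/-- Finitely supported combinations of vectors `v j ∈ X j`, `j ∈ S`, as elements of the product. -/
noncomputable def diagonalEmbedding {X : ℕ → Type*} [∀ j, AddCommGroup (X j)]
    [∀ j, Module ℝ (X j)] (S : Set ℕ) (v : ∀ j : S, X j) : (S →₀ ℝ) →ₗ[ℝ] ∀ j, X j :=
  LinearMap.pi fun j =>
    if h : j ∈ S then (Finsupp.lapply (⟨j, h⟩ : S)).smulRight (v ⟨j, h⟩) else 0

theorem diagonalEmbedding_apply_mem {X : ℕ → Type*} [∀ j, AddCommGroup (X j)]
    [∀ j, Module ℝ (X j)] {S : Set ℕ} (v : ∀ j : S, X j) (a : S →₀ ℝ) {j : ℕ} (h : j ∈ S) :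
    diagonalEmbedding S v a j = a ⟨j, h⟩ • v ⟨j, h⟩ := by
  simp [diagonalEmbedding, h]

theorem diagonalEmbedding_apply_notMem {X : ℕ → Type*} [∀ j, AddCommGroup (X j)]
    [∀ j, Module ℝ (X j)] {S : Set ℕ} (v : ∀ j : S, X j) (a : S →₀ ℝ) {j : ℕ} (h : j ∉ S) :
    diagonalEmbedding S v a j = 0 := by
  simp [diagonalEmbedding, h]

theorem diagonalEmbedding_injective {X : ℕ → Type*} [∀ j, AddCommGroup (X j)]
    [∀ j, Module ℝ (X j)] {S : Set ℕ} {v : ∀ j : S, X j} (hv : ∀ j, v j ≠ 0) :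
    Function.Injective (diagonalEmbedding S v) := by
  rw [injective_iff_map_eq_zero]
  intro a ha
  ext ⟨j, hj⟩
  have h := congrFun ha j
  rw [diagonalEmbedding_apply_mem v a hj] at h
  exact (smul_eq_zero.1 h).resolve_right (hv _)

theorem not_finiteDimensional_range_diagonalEmbedding {X : ℕ → Type*}
    [∀ j, AddCommGroup (X j)] [∀ j, Module ℝ (X j)] {S : Set ℕ} (hS : S.Infinite)
    {v : ∀ j : S, X j} (hv : ∀ j, v j ≠ 0) :
    ¬ FiniteDimensional ℝ (LinearMap.range (diagonalEmbedding S v)) := by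
  intro h
  have : FiniteDimensional ℝ (S →₀ ℝ) :=
    (LinearEquiv.ofInjective _ (diagonalEmbedding_injective hv)).symm.finiteDimensional
  have hfin : Finite S :=
    (Finsupp.basisSingleOne (R := ℝ) (ι := S)).linearIndependent.finite
  exact hS (Set.toFinite S)

theorem QuasiNorm.map_zero {V : Type*} [AddCommGroup V] [Module ℝ V] (Q : QuasiNorm V) :
    Q.N 0 = 0 :=
  (Q.definite 0).2 rfl

theorem statement0
    (X Y : ℕ → Type*)
    [∀ j, AddCommGroup (X j)] [∀ j, Module ℝ (X j)]
    [∀ j, AddCommGroup (Y j)] [∀ j, Module ℝ (Y j)]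
    (QX : ∀ j, QuasiNorm (X j)) (QY : ∀ j, QuasiNorm (Y j))
    (T : ∀ j, X j →ₗ[ℝ] Y j)
    (hbdd : (⨆ j, eOpNorm (fun v => ENNReal.ofReal ((QX j).N v))
        (fun w => ENNReal.ofReal ((QY j).N w)) (T j)) ≠ ∞)
    (hlimsup : 0 < Filter.limsup (fun j => eOpNorm
        (fun v => ENNReal.ofReal ((QX j).N v))
        (fun w => ENNReal.ofReal ((QY j).N w)) (T j)) Filter.atTop)
    (q : ℝ≥0∞) (hq : 0 < q) :
    ¬ StrictlySingular
      (fun x : ∀ j, X j => eSeqNorm q fun j => ENNReal.ofReal ((QX j).N (x j)))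
      (fun y : ∀ j, Y j => eSeqNorm q fun j => ENNReal.ofReal ((QY j).N (y j)))
      (LinearMap.pi fun j => (T j).comp (LinearMap.proj j)) := by
  intro hSS
  obtain ⟨c, hc0, hc⟩ := ENNReal.lt_iff_exists_nnreal_btwn.1 hlimsup
  replace hc0 : 0 < (c : ℝ) := by exact_mod_cast hc0
  have hfreq := Filter.frequently_lt_of_lt_limsup (by isBoundedDefault) hc
  let S : Set ℕ := {j | (c : ℝ≥0∞) < eOpNorm (fun v => ENNReal.ofReal ((QX j).N v))
    (fun w => ENNReal.ofReal ((QY j).N w)) (T j)}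
  have hS : S.Infinite := Nat.frequently_atTop_iff_infinite.1 hfreq
  have hex : ∀ j : S, ∃ v : X j, (QX j).N v = 1 ∧ (c : ℝ) < (QY j).N (T j v) := by
    rintro ⟨j, hj⟩
    obtain ⟨⟨v, hv⟩, hlt⟩ := lt_iSup_iff.1 (Set.mem_ofPred_eq ▸ hj)
    refine ⟨v, ENNReal.ofReal_eq_one.1 hv, ?_⟩
    rw [← ENNReal.ofReal_coe_nnreal] at hlt
    exact (ENNReal.ofReal_lt_ofReal_iff_of_nonneg c.2).1 hlt
  choose v hv1 hvc using hex
  have hv0 : ∀ j, v j ≠ 0 := fun j h => by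
    simpa [h, QuasiNorm.map_zero] using hv1 j
  obtain ⟨x, ⟨a, rfl⟩, hx1, hlt⟩ := hSS (LinearMap.range (diagonalEmbedding S v))
    (by
      rintro _ ⟨a, rfl⟩
      refine eSeqNorm_ne_top_of_finite_support hq (fun _ => ENNReal.ofReal_ne_top)
        (a.support.map (Function.Embedding.subtype _)) fun j hj => ?_
      by_cases h : j ∈ S
      · have ha : a ⟨j, h⟩ = 0 := by
          by_contra hne
          exact hj (Finset.mem_map.2 ⟨⟨j, h⟩, Finsupp.mem_support_iff.2 hne, rfl⟩)
        simp [diagonalEmbedding_apply_mem v a h, ha, QuasiNorm.map_zero]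
      · simp [diagonalEmbedding_apply_notMem v a h, QuasiNorm.map_zero])
    (not_finiteDimensional_range_diagonalEmbedding hS hv0) c hc0
  refine hlt.not_ge ?_
  rw [← mul_one (ENNReal.ofReal c), ← hx1, ← eSeqNorm_const_mul hq]
  refine eSeqNorm_mono q fun j => ?_
  rw [← ENNReal.ofReal_mul hc0.le]
  refine ENNReal.ofReal_le_ofReal ?_
  simp only [LinearMap.pi_apply, LinearMap.comp_apply, LinearMap.proj_apply]
  by_cases h : j ∈ S
  · rw [diagonalEmbedding_apply_mem v a h, map_smul, (QX j).norm_smul, (QY j).norm_smul,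
      hv1 ⟨j, h⟩, mul_one, mul_comm]
    exact mul_le_mul_of_nonneg_left (hvc ⟨j, h⟩).le (abs_nonneg _)
  · simp [diagonalEmbedding_apply_notMem v a h, QuasiNorm.map_zero]

end Stmt0
end

section
/- Let (X_j)_{j=0}^∞ and (Y_j)_{j=0}^∞ be Banach spaces and let T_j : X_j → Y_j be bounded linear maps with sup_j ‖T_j‖_{X_j→Y_j} < ∞. For 0 < p < q ≤ ∞ define T̂_{p,q} : ℓ^p((X_j)_j) → ℓ^q((Y_j)_j) by T̂_{p,q}((x_j)_j) = (T_j x_j)_j. If lim_{n→∞} sup_{j≥0} b_n(T_j) = 0, then lim_{n→∞} b_n(T̂_{p,q}) = 0; in particular T̂_{p,q} is finitely strictly singular. -/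
/-!
STATEMENT 1 (diagonal theorem): Let (X_j), (Y_j) be Banach spaces and
T_j : X_j → Y_j bounded linear maps with sup_j ‖T_j‖ < ∞.  For 0 < p < q ≤ ∞,
let T̂_{p,q} : ℓ^p((X_j)_j) → ℓ^q((Y_j)_j) be the diagonal map.  If
lim_n sup_j b_n(T_j) = 0 then lim_n b_n(T̂_{p,q}) = 0; in particular T̂_{p,q}
is finitely strictly singular.
-/

open scoped ENNReal

namespace Stmt1

/-- The `ℓ^q`-norm of a family of extended-nonnegative numbers. -/
noncomputable def eSeqNorm {ι : Type*} (q : ℝ≥0∞) (f : ι → ℝ≥0∞) : ℝ≥0∞ :=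
  if q = ∞ then ⨆ i, f i else (∑' i, f i ^ q.toReal) ^ (1 / q.toReal)

/-- `T` is finitely strictly singular w.r.t. the (extended-valued) norms `M₀`, `M₁`. -/
def FinStrictlySingular {V₀ V₁ : Type*} [AddCommGroup V₀] [Module ℝ V₀]
    [AddCommGroup V₁] [Module ℝ V₁]
    (M₀ : V₀ → ℝ≥0∞) (M₁ : V₁ → ℝ≥0∞) (T : V₀ →ₗ[ℝ] V₁) : Prop :=
  ∀ ε : ℝ, 0 < ε → ∃ N : ℕ, ∀ Z : Submodule ℝ V₀, (∀ x ∈ Z, M₀ x ≠ ∞) →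
    (N : Cardinal) ≤ Module.rank ℝ Z → ∃ x ∈ Z, M₀ x = 1 ∧ M₁ (T x) ≤ ENNReal.ofReal ε

/-- The `n`-th Bernstein number of `T` w.r.t. the norms `M₀`, `M₁`: the sup over
subspaces `Z` (consisting of elements of finite norm) of dimension at least `n`
of the infimum of `M₁ (T x)` over unit vectors `x ∈ Z`. -/
noncomputable def bernstein {V₀ V₁ : Type*} [AddCommGroup V₀] [Module ℝ V₀]
    [AddCommGroup V₁] [Module ℝ V₁]
    (M₀ : V₀ → ℝ≥0∞) (M₁ : V₁ → ℝ≥0∞) (T : V₀ →ₗ[ℝ] V₁) (n : ℕ) : ℝ≥0∞ :=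
  ⨆ Z : {Z : Submodule ℝ V₀ // (∀ x ∈ Z, M₀ x ≠ ∞) ∧ (n : Cardinal) ≤ Module.rank ℝ Z},
    ⨅ x : {x : V₀ // x ∈ Z.1 ∧ M₀ x = 1}, M₁ (T x.1)

/-- If every subspace of dimension at least `m` contains a unit vector on which `T` is at most `δ`,
then every subspace of dimension at least `m + k` contains a `k`-dimensional subspace on which
`T` has norm at most `2 ^ k * δ`. -/
theorem exists_submodule_norm_le {E F : Type*} [NormedAddCommGroup E] [NormedSpace ℝ E]
    [NormedAddCommGroup F] [NormedSpace ℝ F] (T : E →L[ℝ] F) {δ : ℝ} (hδ : 0 ≤ δ) {m : ℕ}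
    (h : ∀ Z : Submodule ℝ E, FiniteDimensional ℝ Z → m ≤ Module.finrank ℝ Z →
      ∃ x ∈ Z, ‖x‖ = 1 ∧ ‖T x‖ ≤ δ) (k : ℕ) :
    ∀ Z : Submodule ℝ E, FiniteDimensional ℝ Z → m + k ≤ Module.finrank ℝ Z →
      ∃ Z' ≤ Z, k ≤ Module.finrank ℝ Z' ∧ ∀ x ∈ Z', ‖T x‖ ≤ (2 ^ k - 1) * δ * ‖x‖ := by
  induction k with
  | zero =>
    intro Z _ _
    exact ⟨⊥, bot_le, Nat.zero_le _, by simp⟩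
  | succ k ih =>
    intro Z hZ hdim
    obtain ⟨e, heZ, he, hTe⟩ := h Z hZ (by omega)
    obtain ⟨f, hf, hfe⟩ := exists_dual_vector ℝ e (by simp [he])
    have hfe1 : f e = 1 := by simpa [he] using hfe
    let g : Z →ₗ[ℝ] ℝ := (f : E →ₗ[ℝ] ℝ).comp Z.subtype
    have hker : m + k ≤ Module.finrank ℝ ((LinearMap.ker g).map Z.subtype) := by
      rw [Submodule.finrank_map_subtype_eq]
      have h1 := g.finrank_range_add_finrank_ker
      have h2 := (LinearMap.range g).finrank_le
      rw [Module.finrank_self] at h2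
      omega
    obtain ⟨W, hW, hkW, hTW⟩ := ih _ inferInstance hker
    have hWZ : W ≤ Z := hW.trans (Submodule.map_subtype_le _ _)
    have hfW : ∀ y ∈ W, f y = 0 := by
      intro y hy
      obtain ⟨z, hz, rfl⟩ := hW hy
      exact hz
    have hle : W ⊔ Submodule.span ℝ {e} ≤ Z :=
      sup_le hWZ ((Submodule.span_singleton_le_iff_mem _ _).2 heZ)
    refine ⟨W ⊔ Submodule.span ℝ {e}, hle, ?_, ?_⟩
    · have hlt : W < W ⊔ Submodule.span ℝ {e} := by
        refine lt_of_le_not_ge le_sup_left fun hge => ?_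
        have := hfW e (hge (Submodule.mem_sup_right (Submodule.mem_span_singleton_self e)))
        rw [hfe1] at this
        exact one_ne_zero this
      have : FiniteDimensional ℝ (W ⊔ Submodule.span ℝ {e} : Submodule ℝ E) :=
        Submodule.finiteDimensional_of_le hle
      have := Submodule.finrank_lt_finrank_of_lt hlt
      omega
    · intro x hx
      obtain ⟨y, hy, z, hz, rfl⟩ := Submodule.mem_sup.1 hx
      obtain ⟨a, rfl⟩ := Submodule.mem_span_singleton.1 hz
      have ha : |a| ≤ ‖y + a • e‖ := by
        have := f.le_opNorm (y + a • e)
        simpa [hf, hfW y hy, hfe1] using this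
      have hy' : ‖y‖ ≤ 2 * ‖y + a • e‖ := by
        have : ‖y‖ ≤ ‖y + a • e‖ + ‖a • e‖ := by
          simpa using norm_sub_le (y + a • e) (a • e)
        rw [norm_smul, he, Real.norm_eq_abs] at this
        linarith
      have h2 : (0 : ℝ) ≤ 2 ^ k - 1 := by
        have := one_le_pow₀ (M₀ := ℝ) (a := 2) (n := k) (by norm_num)
        linarith
      calc ‖T (y + a • e)‖ ≤ ‖T y‖ + ‖T (a • e)‖ := by
            rw [map_add]; exact norm_add_le _ _
        _ = ‖T y‖ + |a| * ‖T e‖ := by rw [map_smul, norm_smul, Real.norm_eq_abs]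
        _ ≤ (2 ^ k - 1) * δ * (2 * ‖y + a • e‖) + ‖y + a • e‖ * δ := by
            gcongr
            exact (hTW y hy).trans (by gcongr)
        _ = (2 ^ (k + 1) - 1) * δ * ‖y + a • e‖ := by ring

section Family

variable {X Y : ℕ → Type*}
  [∀ j, NormedAddCommGroup (X j)] [∀ j, NormedSpace ℝ (X j)]
  [∀ j, NormedAddCommGroup (Y j)] [∀ j, NormedSpace ℝ (Y j)]

/-- A uniform bound on the dimension ensures that a subspace of the product contains a
`k`-dimensional subspace on which `L` prescribed coordinates of the diagonal map are small. -/
theorem exists_submodule_forall_mem_finset (T : ∀ j, X j →L[ℝ] Y j) {ε : ℝ}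
    (hT : ∀ k : ℕ, ∃ M : ℕ, ∀ j, ∀ Z : Submodule ℝ (X j), FiniteDimensional ℝ Z →
      M ≤ Module.finrank ℝ Z →
      ∃ Z' ≤ Z, k ≤ Module.finrank ℝ Z' ∧ ∀ x ∈ Z', ‖T j x‖ ≤ ε * ‖x‖) (L : ℕ) :
    ∀ k : ℕ, ∃ M : ℕ, ∀ J : Finset ℕ, J.card ≤ L → ∀ Z : Submodule ℝ (∀ j, X j),
      FiniteDimensional ℝ Z → M ≤ Module.finrank ℝ Z →
      ∃ Z' ≤ Z, k ≤ Module.finrank ℝ Z' ∧ ∀ x ∈ Z', ∀ j ∈ J, ‖T j (x j)‖ ≤ ε * ‖x j‖ := by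
  induction L with
  | zero =>
    refine fun k => ⟨k, fun J hJ Z _ hk => ⟨Z, le_rfl, hk, ?_⟩⟩
    simp [Finset.card_eq_zero.1 (Nat.le_zero.1 hJ)]
  | succ L ih =>
    intro k
    obtain ⟨m, hm⟩ := hT k
    obtain ⟨M, hM⟩ := ih (k + m)
    refine ⟨M + k, fun J hJ Z hZ hdim => ?_⟩
    rcases J.eq_empty_or_nonempty with rfl | ⟨i, hi⟩
    · exact ⟨Z, le_rfl, by omega, by simp⟩
    have hcard := Finset.card_erase_of_mem hi
    obtain ⟨W, hWZ, hW, hTW⟩ := hM (J.erase i) (by omega) Z hZ (by omega)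
    have hWfin : FiniteDimensional ℝ W := Submodule.finiteDimensional_of_le hWZ
    let φ : (∀ j, X j) →ₗ[ℝ] X i := LinearMap.proj i
    have hsplit : ∀ W' ≤ W, (∀ x ∈ W', ‖T i (x i)‖ ≤ ε * ‖x i‖) →
        ∀ x ∈ W', ∀ j ∈ J, ‖T j (x j)‖ ≤ ε * ‖x j‖ := by
      intro W' hW' h x hx j hj
      by_cases hji : j = i
      · subst hji
        exact h x hx
      · exact hTW x (hW' hx) j (Finset.mem_erase.2 ⟨hji, hj⟩)
    have hrank := (φ.comp W.subtype).finrank_range_add_finrank_ker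
    by_cases hker : k ≤ Module.finrank ℝ (LinearMap.ker (φ.comp W.subtype))
    · have hle := Submodule.map_subtype_le W (LinearMap.ker (φ.comp W.subtype))
      refine ⟨_, hle.trans hWZ, ?_, hsplit _ hle ?_⟩
      · rwa [Submodule.finrank_map_subtype_eq]
      · rintro _ ⟨z, hz, rfl⟩
        have : z.1 i = 0 := hz
        simp [this]
    · obtain ⟨V, hV, hkV, hTV⟩ :=
        hm i (LinearMap.range (φ.comp W.subtype)) inferInstance (by omega)
      refine ⟨W ⊓ V.comap φ, inf_le_left.trans hWZ, ?_, hsplit _ inf_le_left ?_⟩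
      · have hVle : V ≤ (W ⊓ V.comap φ).map φ := by
          intro v hv
          obtain ⟨w, rfl⟩ := hV hv
          exact ⟨w.1, ⟨w.2, hv⟩, rfl⟩
        have : FiniteDimensional ℝ (W ⊓ V.comap φ : Submodule ℝ (∀ j, X j)) :=
          Submodule.finiteDimensional_of_le inf_le_left
        exact (hkV.trans (Submodule.finrank_mono hVle)).trans (Submodule.finrank_map_le φ _)
      · exact fun x hx => hTV _ hx.2

/-- Main argument, with the `ℓ^p`-quasi-norm replaced by any homogeneous functional that
dominates `(#S) ^ (1 / p) * r` as soon as `S` is a finite set of coordinates of norm at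
least `r`. -/
theorem exists_unit_forall_norm_le (T : ∀ j, X j →L[ℝ] Y j) {c : ℝ} (hc : 1 ≤ c)
    (hTc : ∀ j, ‖T j‖ ≤ c)
    (hT : ∀ ε : ℝ, 0 < ε → ∀ k : ℕ, ∃ M : ℕ, ∀ j, ∀ Z : Submodule ℝ (X j),
      FiniteDimensional ℝ Z → M ≤ Module.finrank ℝ Z →
      ∃ Z' ≤ Z, k ≤ Module.finrank ℝ Z' ∧ ∀ x ∈ Z', ‖T j x‖ ≤ ε * ‖x‖)
    {p : ℝ} (hp : 0 < p) {ε : ℝ} (hε : 0 < ε) :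
    ∃ N : ℕ, ∀ Z : Submodule ℝ (∀ j, X j), FiniteDimensional ℝ Z → N ≤ Module.finrank ℝ Z →
      ∀ ν : (∀ j, X j) → ℝ, (∀ x, 0 ≤ ν x) → (∀ x, ∀ a : ℝ, ν (a • x) = |a| * ν x) →
      (∀ x ∈ Z, ∀ S : Finset ℕ, ∀ r : ℝ, 0 ≤ r → (∀ j ∈ S, r ≤ ‖x j‖) →
        S.card * r ^ p ≤ ν x ^ p) →
      ∃ x ∈ Z, ν x = 1 ∧ ∀ j, ‖T j (x j)‖ ≤ ε := by
  have hc0 : 0 < c := by linarith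
  obtain ⟨k, hk⟩ := exists_nat_gt (((c + ε / 2) / ε) ^ p / (ε / (2 * c)) ^ p)
  have hk0 : 0 < (k : ℝ) := lt_of_le_of_lt (by positivity) hk
  set τ : ℝ := ε / (2 * k) with hτ
  have hτ0 : 0 < τ := by positivity
  have hkτ : k * τ = ε / 2 := by rw [hτ]; field_simp
  have hτε : τ < ε := by
    have : (1 : ℝ) ≤ k := by exact_mod_cast (Nat.cast_pos.1 hk0)
    nlinarith
  obtain ⟨L, hL⟩ := exists_nat_gt (1 / (τ / c) ^ p)
  obtain ⟨N, hN⟩ := exists_submodule_forall_mem_finset T (hT τ hτ0) (k * L) 1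
  refine ⟨N, fun Z hZ hNZ ν hν0 hν hνS => ?_⟩
  have hνpos : ∀ x ∈ Z, ∀ j, x j ≠ 0 → 0 < ν x := by
    intro x hx j hj
    refine (hν0 x).lt_of_ne fun h0 => ?_
    have := hνS x hx {j} ‖x j‖ (norm_nonneg _) (by simp)
    rw [← h0, Real.zero_rpow hp.ne', Finset.card_singleton, Nat.cast_one, one_mul] at this
    exact absurd this (not_le.2 (Real.rpow_pos_of_pos (norm_pos_iff.2 hj) p))
  have hcoord : ∀ x ∈ Z, ν x = 1 → ∀ j, ‖x j‖ ≤ 1 := by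
    intro x hx h1 j
    have := hνS x hx {j} ‖x j‖ (norm_nonneg _) (by simp)
    rw [h1, Finset.card_singleton, Nat.cast_one, one_mul] at this
    exact (Real.rpow_le_rpow_iff (norm_nonneg _) zero_le_one hp).1 this
  have hTle : ∀ j (v : X j), ‖T j v‖ ≤ c * ‖v‖ := fun j v =>
    (T j).le_of_opNorm_le (hTc j) v
  have hvec : ∀ A : Finset ℕ, ∃ x, A.card ≤ k * L →
      x ∈ Z ∧ ν x = 1 ∧ ∀ j ∈ A, ‖T j (x j)‖ ≤ τ := by
    intro A
    by_cases hA : A.card ≤ k * L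
    swap
    · exact ⟨0, fun h => absurd h hA⟩
    obtain ⟨W, hWZ, hW, hTW⟩ := hN A hA Z hZ hNZ
    have hWne : W ≠ ⊥ := by
      rintro rfl
      simp at hW
    obtain ⟨y, hy, hy0⟩ := W.exists_mem_ne_zero_of_ne_bot hWne
    obtain ⟨i, hi⟩ := Function.ne_iff.1 hy0
    have hνy := hνpos y (hWZ hy) i hi
    have hmem : (ν y)⁻¹ • y ∈ W := W.smul_mem _ hy
    have hone : ν ((ν y)⁻¹ • y) = 1 := by
      rw [hν, abs_of_pos (inv_pos.2 hνy), inv_mul_cancel₀ hνy.ne']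
    refine ⟨(ν y)⁻¹ • y, fun _ => ⟨hWZ hmem, hone, fun j hj => ?_⟩⟩
    calc _ ≤ τ * ‖((ν y)⁻¹ • y) j‖ := hTW _ hmem j hj
      _ ≤ τ * 1 := by gcongr; exact hcoord _ (hWZ hmem) hone j
      _ = τ := mul_one _
  have hlarge : ∀ x : ∀ j, X j, ∃ J : Finset ℕ, x ∈ Z → ν x = 1 →
      J.card ≤ L ∧ ∀ j ∉ J, ‖x j‖ ≤ τ / c := by
    intro x
    by_cases hx : x ∈ Z ∧ ν x = 1
    swap
    · exact ⟨∅, fun h1 h2 => absurd ⟨h1, h2⟩ hx⟩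
    have hbound : ∀ S : Finset ℕ, (S : Set ℕ) ⊆ {j | τ / c < ‖x j‖} → S.card ≤ L := by
      intro S hS
      have h1 := hνS x hx.1 S (τ / c) (by positivity) fun j hj => (hS hj).le
      rw [hx.2, Real.one_rpow, ← le_div_iff₀ (by positivity)] at h1
      exact_mod_cast h1.trans hL.le
    have hfin : {j | τ / c < ‖x j‖}.Finite := by
      by_contra hinf
      obtain ⟨S, hS, hcard⟩ := Set.Infinite.exists_subset_card_eq hinf (L + 1)
      have := hbound S hS
      omega
    refine ⟨hfin.toFinset, fun _ _ => ⟨hbound _ (by simp), fun j hj => ?_⟩⟩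
    simpa using hj
  choose g hg using hvec
  choose J hJ using hlarge
  let A : ℕ → Finset ℕ := fun i => Nat.rec ∅ (fun _ B => B ∪ J (g B)) i
  have hA0 : A 0 = ∅ := rfl
  have hAs : ∀ i, A (i + 1) = A i ∪ J (g (A i)) := fun _ => rfl
  clear_value A
  have hAmono : Monotone A := monotone_nat_of_le_succ fun i => by
    rw [hAs]; exact Finset.subset_union_left
  have hAcard : ∀ i, i ≤ k → (A i).card ≤ i * L := by
    intro i
    induction i with
    | zero => simp [hA0]
    | succ i ih =>
      intro hi
      have h1 := ih (by omega)
      have h2 := hg (A i) (h1.trans (Nat.mul_le_mul_right L (by omega)))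
      have h3 := (hJ (g (A i)) h2.1 h2.2.1).1
      rw [hAs]
      calc _ ≤ _ := Finset.card_union_le _ _
        _ ≤ i * L + L := add_le_add h1 h3
        _ = _ := by ring
  have hx : ∀ i < k, g (A i) ∈ Z ∧ ν (g (A i)) = 1 ∧ ∀ j ∈ A i, ‖T j (g (A i) j)‖ ≤ τ :=
    fun i hi => hg (A i) ((hAcard i hi.le).trans (Nat.mul_le_mul_right L hi.le))
  have hsmall : ∀ i < k, ∀ j ∉ A (i + 1), ‖T j (g (A i) j)‖ ≤ τ := by
    intro i hi j hj
    rw [hAs, Finset.mem_union, not_or] at hj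
    calc _ ≤ c * ‖g (A i) j‖ := hTle _ _
      _ ≤ c * (τ / c) := by
        gcongr
        exact (hJ _ (hx i hi).1 (hx i hi).2.1).2 j hj.2
      _ = τ := by field_simp
  have hpeak : ∀ j, ∃ i₀, ∀ i < k, i ≠ i₀ → ‖T j (g (A i) j)‖ ≤ τ := by
    intro j
    classical
    by_cases hj : ∃ m, j ∈ A m
    · have hspec := Nat.find_spec hj
      have hmin : ∀ i, i < Nat.find hj → j ∉ A i := fun i => Nat.find_min hj
      refine ⟨Nat.find hj - 1, fun i hi hne => ?_⟩
      rcases lt_or_ge i (Nat.find hj) with hlt | hge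
      · exact hsmall i hi j (hmin _ (by omega))
      · exact (hx i hi).2.2 j (hAmono hge hspec)
    · push Not at hj
      exact ⟨0, fun i hi _ => hsmall i hi j (hj (i + 1))⟩
  by_contra! hcon
  have hbig : ∀ i : Fin k, ∃ j, ε < ‖T j (g (A i) j)‖ := fun i =>
    hcon _ (hx i i.2).1 (hx i i.2).2.1
  choose j hj using hbig
  have hpeak' : ∀ i : Fin k, ∀ l : Fin k, l ≠ i → ‖T (j i) (g (A l) (j i))‖ ≤ τ := by
    intro i l hl
    obtain ⟨i₀, hi₀⟩ := hpeak (j i)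
    have hii : (i : ℕ) = i₀ := by
      by_contra hne
      linarith [hi₀ i i.2 hne, hj i]
    exact hi₀ l l.2 fun h => hl (Fin.ext (h.trans hii.symm))
  have hinj : Function.Injective j := by
    intro i l hil
    by_contra hne
    have := hpeak' i l (Ne.symm hne)
    rw [hil] at this
    linarith [hj l]
  set x : ∀ j, X j := ∑ i : Fin k, g (A i) with hxdef
  have hxZ : x ∈ Z := Z.sum_mem fun i _ => (hx i i.2).1
  have hTx : ∀ m, T m (x m) = ∑ i : Fin k, T m (g (A i) m) := by
    intro m
    rw [hxdef, Finset.sum_apply, map_sum]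
  have hupper : ∀ m, ‖T m (x m)‖ ≤ c + ε / 2 := by
    intro m
    obtain ⟨i₀, hi₀⟩ := hpeak m
    have hterm : ∀ i : Fin k, ‖T m (g (A i) m)‖ ≤ (if (i : ℕ) = i₀ then c else 0) + τ := by
      intro i
      split_ifs with h
      · have h1 := hTle m (g (A i) m)
        have h2 := hcoord _ (hx i i.2).1 (hx i i.2).2.1 m
        nlinarith
      · simpa using hi₀ i i.2 h
    have hone : ∑ i : Fin k, (if (i : ℕ) = i₀ then c else 0) ≤ c := by
      rw [Fin.sum_univ_eq_sum_range (fun i => if i = i₀ then c else 0) k, Finset.sum_ite_eq']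
      split_ifs <;> linarith
    calc ‖T m (x m)‖ ≤ ∑ i : Fin k, ‖T m (g (A i) m)‖ := by rw [hTx]; exact norm_sum_le _ _
      _ ≤ ∑ i : Fin k, ((if (i : ℕ) = i₀ then c else 0) + τ) :=
        Finset.sum_le_sum fun i _ => hterm i
      _ ≤ c + ε / 2 := by
        rw [Finset.sum_add_distrib, Finset.sum_const, Finset.card_univ, Fintype.card_fin,
          nsmul_eq_mul, hkτ]
        linarith
  have hlower : ∀ i : Fin k, ε / (2 * c) ≤ ‖x (j i)‖ := by
    intro i
    have hsum : ‖∑ l ∈ Finset.univ.erase i, T (j i) (g (A l) (j i))‖ ≤ ε / 2 := by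
      calc _ ≤ ∑ l ∈ Finset.univ.erase i, τ :=
            norm_sum_le_of_le _ fun l hl => hpeak' i l (Finset.ne_of_mem_erase hl)
        _ ≤ ∑ l : Fin k, τ :=
            Finset.sum_le_sum_of_subset_of_nonneg (Finset.erase_subset _ _)
              fun _ _ _ => hτ0.le
        _ = ε / 2 := by simp [hkτ]
    have h1 : T (j i) (x (j i)) = T (j i) (g (A i) (j i)) +
        ∑ l ∈ Finset.univ.erase i, T (j i) (g (A l) (j i)) := by
      rw [hTx]
      exact (Finset.add_sum_erase _ (fun l : Fin k => T (j i) (g (A l) (j i)))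
        (Finset.mem_univ i)).symm
    have h2 : ε / 2 ≤ ‖T (j i) (x (j i))‖ := by
      rw [h1]
      have := norm_sub_le_norm_add (T (j i) (g (A i) (j i)))
        (∑ l ∈ Finset.univ.erase i, T (j i) (g (A l) (j i)))
      linarith [hj i]
    have h3 := hTle (j i) (x (j i))
    rw [div_le_iff₀ (by positivity)]
    linarith
  have hcount := hνS x hxZ (Finset.univ.map ⟨j, hinj⟩) (ε / (2 * c)) (by positivity) (by simpa)
  rw [Finset.card_map, Finset.card_univ, Fintype.card_fin] at hcount
  have hνx : 0 < ν x := by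
    refine (hν0 x).lt_of_ne fun h0 => ?_
    rw [← h0, Real.zero_rpow hp.ne'] at hcount
    have : 0 < (k : ℝ) * (ε / (2 * c)) ^ p := by positivity
    linarith
  obtain ⟨m, hm⟩ := hcon ((ν x)⁻¹ • x) (Z.smul_mem _ hxZ) (by
    rw [hν, abs_of_pos (inv_pos.2 hνx), inv_mul_cancel₀ hνx.ne'])
  rw [Pi.smul_apply, map_smul, norm_smul, Real.norm_eq_abs, abs_of_pos (inv_pos.2 hνx),
    ← div_eq_inv_mul, lt_div_iff₀ hνx] at hm
  have hνle : ν x ≤ (c + ε / 2) / ε := by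
    rw [le_div_iff₀ hε]
    linarith [hupper m]
  have := hcount.trans (Real.rpow_le_rpow hνx.le hνle hp.le)
  rw [div_lt_iff₀ (by positivity)] at hk
  linarith

end Family

theorem eSeqNorm_const_mul {ι : Type*} {p : ℝ≥0∞} (hp : 0 < p) (hp' : p ≠ ∞) (a : ℝ≥0∞)
    (f : ι → ℝ≥0∞) : eSeqNorm p (fun i => a * f i) = a * eSeqNorm p f := by
  have hP := ENNReal.toReal_pos hp.ne' hp'
  simp only [eSeqNorm, if_neg hp', ENNReal.mul_rpow_of_nonneg _ _ hP.le, ENNReal.tsum_mul_left]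
  rw [ENNReal.mul_rpow_of_nonneg _ _ (by positivity), ← ENNReal.rpow_mul,
    mul_one_div_cancel hP.ne', ENNReal.rpow_one]

theorem eSeqNorm_rpow {ι : Type*} {p : ℝ≥0∞} (hp : 0 < p) (hp' : p ≠ ∞) (f : ι → ℝ≥0∞) :
    eSeqNorm p f ^ p.toReal = ∑' i, f i ^ p.toReal := by
  rw [eSeqNorm, if_neg hp', ← ENNReal.rpow_mul,
    one_div_mul_cancel (ENNReal.toReal_pos hp.ne' hp').ne', ENNReal.rpow_one]

/-- Interpolation: a family dominated by an `ℓ^p`-unit vector that is uniformly small is small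
in `ℓ^q` for every `q > p`. -/
theorem exists_eSeqNorm_le_of_forall_le {ι : Type*} {p q : ℝ≥0∞} (hp : 0 < p) (hpq : p < q)
    {c : ℝ} (hc : 0 < c) {ε : ℝ} (hε : 0 < ε) :
    ∃ δ : ℝ, 0 < δ ∧ ∀ f h : ι → ℝ≥0∞, eSeqNorm p f = 1 →
      (∀ i, h i ≤ ENNReal.ofReal c * f i) → (∀ i, h i ≤ ENNReal.ofReal δ) →
      eSeqNorm q h ≤ ENNReal.ofReal ε := by
  rcases eq_or_ne q ∞ with rfl | hq
  · refine ⟨ε, hε, fun f h _ _ hδ => ?_⟩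
    rw [eSeqNorm, if_pos rfl]
    exact iSup_le hδ
  have hP := ENNReal.toReal_pos hp.ne' hpq.ne_top
  have hPQ : p.toReal < q.toReal := (ENNReal.toReal_lt_toReal hpq.ne_top hq).2 hpq
  set P := p.toReal with hPdef
  set Q := q.toReal with hQdef
  have hQ : 0 < Q := hP.trans hPQ
  have hsub : 0 < Q - P := sub_pos.2 hPQ
  refine ⟨(ε ^ Q / c ^ P) ^ (1 / (Q - P)), by positivity, fun f h hf hfh hδ => ?_⟩
  set δ : ℝ := (ε ^ Q / c ^ P) ^ (1 / (Q - P)) with hδdef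
  have hδ0 : 0 < δ := by positivity
  have hδpow : δ ^ (Q - P) * c ^ P = ε ^ Q := by
    rw [hδdef, ← Real.rpow_mul (by positivity), one_div_mul_cancel hsub.ne', Real.rpow_one]
    field_simp
  have hsum : ∑' i, f i ^ P = 1 := by
    rw [← eSeqNorm_rpow hp hpq.ne_top, hf, ENNReal.one_rpow]
  have hterm : ∀ i, h i ^ Q ≤ ENNReal.ofReal (ε ^ Q) * f i ^ P := by
    intro i
    calc h i ^ Q = h i ^ (Q - P) * h i ^ P := by
          rw [← ENNReal.rpow_add_of_nonneg _ _ hsub.le hP.le, sub_add_cancel]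
      _ ≤ ENNReal.ofReal δ ^ (Q - P) * (ENNReal.ofReal c * f i) ^ P :=
          mul_le_mul' (ENNReal.rpow_le_rpow (hδ i) hsub.le)
            (ENNReal.rpow_le_rpow (hfh i) hP.le)
      _ = ENNReal.ofReal (ε ^ Q) * f i ^ P := by
          rw [ENNReal.mul_rpow_of_nonneg _ _ hP.le, ENNReal.ofReal_rpow_of_pos hδ0,
            ENNReal.ofReal_rpow_of_pos hc, ← mul_assoc, ← ENNReal.ofReal_mul (by positivity),
            hδpow]
  have htsum : ∑' i, h i ^ Q ≤ ENNReal.ofReal (ε ^ Q) := by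
    calc _ ≤ ∑' i, ENNReal.ofReal (ε ^ Q) * f i ^ P := ENNReal.tsum_le_tsum hterm
      _ = _ := by rw [ENNReal.tsum_mul_left, hsum, mul_one]
  rw [eSeqNorm, if_neg hq, ← hQdef]
  calc _ ≤ ENNReal.ofReal (ε ^ Q) ^ (1 / Q) := ENNReal.rpow_le_rpow htsum (by positivity)
    _ = ENNReal.ofReal ε := by
      rw [ENNReal.ofReal_rpow_of_pos (by positivity), ← Real.rpow_mul hε.le,
        mul_one_div_cancel hQ.ne', Real.rpow_one]

/-- Vanishing of the Bernstein numbers follows from finite strict singularity. -/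
theorem FinStrictlySingular.tendsto_bernstein {V₀ V₁ : Type*} [AddCommGroup V₀] [Module ℝ V₀]
    [AddCommGroup V₁] [Module ℝ V₁] {M₀ : V₀ → ℝ≥0∞} {M₁ : V₁ → ℝ≥0∞} {T : V₀ →ₗ[ℝ] V₁}
    (h : FinStrictlySingular M₀ M₁ T) :
    Filter.Tendsto (bernstein M₀ M₁ T) Filter.atTop (nhds 0) := by
  rw [ENNReal.tendsto_atTop_zero]
  intro ε hε
  obtain ⟨η, hη, hηε⟩ := ENNReal.lt_iff_exists_nnreal_btwn.1 hε
  obtain ⟨N, hN⟩ := h η (by exact_mod_cast hη)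
  refine ⟨N, fun n hn => iSup_le fun Z => ?_⟩
  obtain ⟨x, hx, hx1, hTx⟩ := hN Z.1 Z.2.1 ((Nat.cast_le.2 hn).trans Z.2.2)
  rw [ENNReal.ofReal_coe_nnreal] at hTx
  exact (iInf_le (fun x : {x : V₀ // x ∈ Z.1 ∧ M₀ x = 1} => M₁ (T x.1)) ⟨x, hx, hx1⟩).trans
    (hTx.trans hηε.le)

theorem exists_norm_le_of_bernstein_lt {E F : Type*} [NormedAddCommGroup E] [NormedSpace ℝ E]
    [NormedAddCommGroup F] [NormedSpace ℝ F] (T : E →L[ℝ] F) {δ : ℝ} (hδ : 0 < δ) {m : ℕ}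
    (h : bernstein (fun v => ENNReal.ofReal ‖v‖) (fun w => ENNReal.ofReal ‖w‖)
      (T : E →ₗ[ℝ] F) m < ENNReal.ofReal δ)
    (Z : Submodule ℝ E) (hZ : FiniteDimensional ℝ Z) (hm : m ≤ Module.finrank ℝ Z) :
    ∃ x ∈ Z, ‖x‖ = 1 ∧ ‖T x‖ ≤ δ := by
  have hrank : (m : Cardinal) ≤ Module.rank ℝ Z := by
    rw [← Module.finrank_eq_rank]
    exact_mod_cast hm
  have hlt := (le_iSup (fun Z : {Z : Submodule ℝ E // (∀ x ∈ Z, ENNReal.ofReal ‖x‖ ≠ ∞) ∧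
    (m : Cardinal) ≤ Module.rank ℝ Z} => ⨅ x : {x : E // x ∈ Z.1 ∧ ENNReal.ofReal ‖x‖ = 1},
      ENNReal.ofReal ‖T x.1‖) ⟨Z, fun _ _ => ENNReal.ofReal_ne_top, hrank⟩).trans_lt h
  obtain ⟨⟨x, hxZ, hx⟩, hTx⟩ := iInf_lt_iff.1 hlt
  exact ⟨x, hxZ, ENNReal.ofReal_eq_one.1 hx, ((ENNReal.ofReal_lt_ofReal_iff hδ).1 hTx).le⟩

theorem exists_finiteDimensional_le_of_le_rank {V : Type*} [AddCommGroup V] [Module ℝ V]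
    (Z : Submodule ℝ V) {n : ℕ} (h : (n : Cardinal) ≤ Module.rank ℝ Z) :
    ∃ Z' ≤ Z, FiniteDimensional ℝ Z' ∧ Module.finrank ℝ Z' = n := by
  obtain ⟨f, hf⟩ := Module.le_rank_iff_exists_linearMap.1 h
  refine ⟨LinearMap.range (Z.subtype.comp f), ?_, inferInstance, ?_⟩
  · rintro _ ⟨y, rfl⟩
    exact (f y).2
  · have hinj : Function.Injective (Z.subtype.comp f) := Z.subtype_injective.comp hf
    rw [LinearMap.finrank_range_of_inj hinj, Module.finrank_fin_fun]

theorem statement1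
    (X Y : ℕ → Type*)
    [∀ j, NormedAddCommGroup (X j)] [∀ j, NormedSpace ℝ (X j)] [∀ j, CompleteSpace (X j)]
    [∀ j, NormedAddCommGroup (Y j)] [∀ j, NormedSpace ℝ (Y j)] [∀ j, CompleteSpace (Y j)]
    (T : ∀ j, X j →L[ℝ] Y j)
    (hbdd : ∃ c : ℝ, ∀ j, ‖T j‖ ≤ c)
    (p q : ℝ≥0∞) (hp : 0 < p) (hpq : p < q)
    (hB : Filter.Tendsto
      (fun n : ℕ => ⨆ j, bernstein (fun v => ENNReal.ofReal ‖v‖)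
        (fun w => ENNReal.ofReal ‖w‖) (T j : X j →ₗ[ℝ] Y j) n)
      Filter.atTop (nhds 0)) :
    Filter.Tendsto
      (fun n : ℕ => bernstein
        (fun x : ∀ j, X j => eSeqNorm p fun j => ENNReal.ofReal ‖x j‖)
        (fun y : ∀ j, Y j => eSeqNorm q fun j => ENNReal.ofReal ‖y j‖)
        (LinearMap.pi fun j => (T j : X j →ₗ[ℝ] Y j).comp (LinearMap.proj j)) n)
      Filter.atTop (nhds 0)
    ∧ FinStrictlySingular
        (fun x : ∀ j, X j => eSeqNorm p fun j => ENNReal.ofReal ‖x j‖)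
        (fun y : ∀ j, Y j => eSeqNorm q fun j => ENNReal.ofReal ‖y j‖)
        (LinearMap.pi fun j => (T j : X j →ₗ[ℝ] Y j).comp (LinearMap.proj j)) := by
  refine (fun h => ⟨FinStrictlySingular.tendsto_bernstein h, h⟩) ?_
  obtain ⟨c₀, hc₀⟩ := hbdd
  have hc : 1 ≤ max c₀ 1 := le_max_right _ _
  have hTc : ∀ j, ‖T j‖ ≤ max c₀ 1 := fun j => (hc₀ j).trans (le_max_left _ _)
  generalize max c₀ 1 = c at hc hTc
  have hp' := hpq.ne_top
  have hT : ∀ ε : ℝ, 0 < ε → ∀ k : ℕ, ∃ M : ℕ, ∀ j, ∀ Z : Submodule ℝ (X j),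
      FiniteDimensional ℝ Z → M ≤ Module.finrank ℝ Z →
      ∃ Z' ≤ Z, k ≤ Module.finrank ℝ Z' ∧ ∀ x ∈ Z', ‖T j x‖ ≤ ε * ‖x‖ := by
    intro ε hε k
    have hδ : 0 < ε / 2 ^ k := by positivity
    obtain ⟨m, hm⟩ := (hB.eventually_lt_const (ENNReal.ofReal_pos.2 hδ)).exists
    refine ⟨m + k, fun j Z hZ hdim => ?_⟩
    obtain ⟨Z', hZ', hk, hTZ'⟩ := exists_submodule_norm_le (T j) hδ.le
      (exists_norm_le_of_bernstein_lt (T j) hδ 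
        ((le_iSup (fun j => bernstein (fun v => ENNReal.ofReal ‖v‖) (fun w => ENNReal.ofReal ‖w‖)
          (T j : X j →ₗ[ℝ] Y j) m) j).trans_lt hm)) k Z hZ hdim
    refine ⟨Z', hZ', hk, fun x hx => (hTZ' x hx).trans ?_⟩
    gcongr
    calc (2 ^ k - 1) * (ε / 2 ^ k) ≤ 2 ^ k * (ε / 2 ^ k) := by gcongr; linarith
      _ = ε := by field_simp
  intro ε hε
  obtain ⟨δ, hδ, hinterp⟩ := exists_eSeqNorm_le_of_forall_le (ι := ℕ) hp hpq
    (zero_lt_one.trans_le hc) hε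
  obtain ⟨N, hN⟩ := exists_unit_forall_norm_le T hc hTc hT (ENNReal.toReal_pos hp.ne' hp') hδ
  refine ⟨N, fun Z hfin hrank => ?_⟩
  obtain ⟨W, hWZ, hWfin, hW⟩ := exists_finiteDimensional_le_of_le_rank Z hrank
  obtain ⟨x, hxW, hx, hTx⟩ : ∃ x ∈ W, (eSeqNorm p fun j => ENNReal.ofReal ‖x j‖).toReal = 1 ∧
      ∀ j, ‖T j (x j)‖ ≤ δ := by
    refine hN W hWfin hW.ge (fun x => (eSeqNorm p fun j => ENNReal.ofReal ‖x j‖).toReal)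
      (fun _ => ENNReal.toReal_nonneg) (fun x a => ?_) (fun x hx S r hr hS => ?_)
    · simp only [Pi.smul_apply, norm_smul, ENNReal.ofReal_mul (norm_nonneg a)]
      rw [eSeqNorm_const_mul hp hp', ENNReal.toReal_mul, ENNReal.toReal_ofReal (norm_nonneg a),
        Real.norm_eq_abs]
    · have hP := ENNReal.toReal_pos hp.ne' hp'
      rw [ENNReal.toReal_rpow, eSeqNorm_rpow hp hp']
      have hne : ∑' j, ENNReal.ofReal ‖x j‖ ^ p.toReal ≠ ∞ := by
        rw [← eSeqNorm_rpow hp hp']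
        exact ENNReal.rpow_ne_top_of_nonneg hP.le (hfin x (hWZ hx))
      rw [← ENNReal.ofReal_le_iff_le_toReal hne]
      calc ENNReal.ofReal (S.card * r ^ p.toReal) = ∑ _j ∈ S, ENNReal.ofReal r ^ p.toReal := by
            rw [Finset.sum_const, nsmul_eq_mul, ENNReal.ofReal_mul (Nat.cast_nonneg _),
              ENNReal.ofReal_natCast, ENNReal.ofReal_rpow_of_nonneg hr hP.le]
        _ ≤ ∑ j ∈ S, ENNReal.ofReal ‖x j‖ ^ p.toReal :=
            Finset.sum_le_sum fun j hj =>
              ENNReal.rpow_le_rpow (ENNReal.ofReal_le_ofReal (hS j hj)) hP.le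
        _ ≤ _ := ENNReal.sum_le_tsum S
  have hx1 : (eSeqNorm p fun j => ENNReal.ofReal ‖x j‖) = 1 :=
    (ENNReal.toReal_eq_one_iff _).1 hx
  refine ⟨x, hWZ hxW, hx1, hinterp _ _ hx1 (fun j => ?_) fun j => ?_⟩
  · rw [← ENNReal.ofReal_mul (zero_le_one.trans hc)]
    exact ENNReal.ofReal_le_ofReal ((T j).le_of_opNorm_le (hTc j) _)
  · exact ENNReal.ofReal_le_ofReal (hTx j)

end Stmt1
end

section
/- For every p ∈ (0,∞) and every q_0, q_1 ∈ (0,∞] with q_0 < q_1, the natural embedding ℓ^{q_0}(L^∞[0,1]) ↪ ℓ^{q_1}(L^p[0,1]) (which acts as the identity on each coordinate, using the inclusion L^∞[0,1] ⊆ L^p[0,1]) is finitely strictly singular. -/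
/-!
STATEMENT 3: For p ∈ (0,∞) and 0 < q₀ < q₁ ≤ ∞, the natural coordinatewise
embedding ℓ^{q₀}(L^∞[0,1]) ↪ ℓ^{q₁}(L^p[0,1]) is finitely strictly singular.

Functions on [0,1] are modelled as a.e.-equivalence classes of functions on ℝ
with respect to Lebesgue measure restricted to [0,1]; the embedding is the
identity map on sequences of such classes, measured in the respective norms.
-/

open scoped ENNReal
open MeasureTheory

namespace Stmt3

/-- Lebesgue measure on `[0,1]`. -/
noncomputable def mu : Measure ℝ := volume.restrict (Set.Icc (0 : ℝ) 1)

/-- The `ℓ^q`-norm of a family of extended-nonnegative numbers. -/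
noncomputable def eSeqNorm {ι : Type*} (q : ℝ≥0∞) (f : ι → ℝ≥0∞) : ℝ≥0∞ :=
  if q = ∞ then ⨆ i, f i else (∑' i, f i ^ q.toReal) ^ (1 / q.toReal)

/-- `T` is finitely strictly singular w.r.t. the (extended-valued) norms `M₀`, `M₁`. -/
def FinStrictlySingular {V₀ V₁ : Type*} [AddCommGroup V₀] [Module ℝ V₀]
    [AddCommGroup V₁] [Module ℝ V₁]
    (M₀ : V₀ → ℝ≥0∞) (M₁ : V₁ → ℝ≥0∞) (T : V₀ →ₗ[ℝ] V₁) : Prop :=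
  ∀ ε : ℝ, 0 < ε → ∃ N : ℕ, ∀ Z : Submodule ℝ V₀, (∀ x ∈ Z, M₀ x ≠ ∞) →
    (N : Cardinal) ≤ Module.rank ℝ Z → ∃ x ∈ Z, M₀ x = 1 ∧ M₁ (T x) ≤ ENNReal.ofReal ε

lemma coeFn_sum_smul {α ι : Type*} [MeasurableSpace α] {μ : Measure α} (s : Finset ι)
    (a : ι → ℝ) (f : ι → (α →ₘ[μ] ℝ)) :
    ⇑(∑ i ∈ s, a i • f i) =ᵐ[μ] fun t => ∑ i ∈ s, a i * f i t := by
  classical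
  induction s using Finset.induction_on with
  | empty => simpa using! AEEqFun.coeFn_zero (α := α) (β := ℝ) (μ := μ)
  | insert i s hi ih =>
    rw [Finset.sum_insert hi]
    filter_upwards [AEEqFun.coeFn_add (a i • f i) (∑ j ∈ s, a j • f j),
      AEEqFun.coeFn_smul (a i) (f i), ih] with t h1 h2 h3
    rw [h1, Finset.sum_insert hi, Pi.add_apply, h2, h3]
    rfl

lemma eLpNorm_two_sq {α : Type*} [MeasurableSpace α] {μ : Measure α} (f : α → ℝ) :
    eLpNorm f 2 μ ^ 2 = ∫⁻ t, ‖f t‖ₑ ^ 2 ∂μ := by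
  have := eLpNorm_nnreal_pow_eq_lintegral (μ := μ) (f := f) (p := 2) (by norm_num)
  simpa using this

lemma sum_sq_le_of_forall_abs_sum_le {ι : Type*} [Fintype ι] (v : ι → ℝ) (C : ℝ)
    (h : ∀ a : EuclideanSpace ℝ ι, |∑ i, a i * v i| ≤ C * ‖a‖) : ∑ i, v i ^ 2 ≤ C ^ 2 := by
  have h1 := h (WithLp.toLp 2 v)
  have h2 : ‖WithLp.toLp 2 v‖ ^ 2 = ∑ i, v i ^ 2 := by simp [EuclideanSpace.norm_sq_eq]
  have h3 : ∑ i, (WithLp.toLp 2 v) i * v i = ∑ i, v i ^ 2 := by simp [pow_two]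
  rw [h3, ← h2, abs_of_nonneg (sq_nonneg _)] at h1
  rw [← h2]
  rcases (norm_nonneg (WithLp.toLp 2 v)).eq_or_lt with h0 | h0
  · simpa [← h0] using sq_nonneg C
  · have : ‖WithLp.toLp 2 v‖ ≤ C := by
      rw [pow_two] at h1
      exact le_of_mul_le_mul_right h1 h0
    gcongr

lemma sum_eLpNorm_two_sq_le {α ι : Type*} [MeasurableSpace α] {μ : Measure α}
    [IsProbabilityMeasure μ] [Fintype ι] (f : ι → (α →ₘ[μ] ℝ)) {C : ℝ} (hC : 0 ≤ C)
    (h : ∀ a : EuclideanSpace ℝ ι,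
      eLpNorm (∑ i, a i • f i : α →ₘ[μ] ℝ) ∞ μ ≤ ENNReal.ofReal (C * ‖a‖)) :
    ∑ i, eLpNorm (f i) 2 μ ^ 2 ≤ ENNReal.ofReal (C ^ 2) := by
  have h1 : ∀ᵐ t ∂μ, ∀ n : ℕ,
      |∑ i, TopologicalSpace.denseSeq (EuclideanSpace ℝ ι) n i * f i t|
        ≤ C * ‖TopologicalSpace.denseSeq (EuclideanSpace ℝ ι) n‖ := by
    rw [ae_all_iff]
    intro n
    have h2 := h (TopologicalSpace.denseSeq (EuclideanSpace ℝ ι) n)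
    rw [eLpNorm_exponent_top] at h2
    filter_upwards [coeFn_sum_smul Finset.univ (TopologicalSpace.denseSeq (EuclideanSpace ℝ ι) n) f,
      ae_le_eLpNormEssSup (μ := μ)
        (f := ⇑(∑ i, TopologicalSpace.denseSeq (EuclideanSpace ℝ ι) n i • f i))] with t h3 h4
    rw [h3] at h4
    have h5 := h4.trans h2
    rwa [← ofReal_norm, ENNReal.ofReal_le_ofReal_iff (by positivity), Real.norm_eq_abs] at h5
  have h6 : ∀ᵐ t ∂μ, ∑ i, f i t ^ 2 ≤ C ^ 2 := by
    filter_upwards [h1] with t ht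
    apply sum_sq_le_of_forall_abs_sum_le
    have hcl : IsClosed {a : EuclideanSpace ℝ ι | |∑ i, a i * f i t| ≤ C * ‖a‖} :=
      isClosed_le (by fun_prop) (by fun_prop)
    intro a
    have := (TopologicalSpace.denseRange_denseSeq (EuclideanSpace ℝ ι)).closure_eq ▸
      Set.mem_univ a
    exact closure_minimal (Set.range_subset_iff.2 ht) hcl this
  calc ∑ i, eLpNorm (f i) 2 μ ^ 2 = ∑ i, ∫⁻ t, ‖f i t‖ₑ ^ 2 ∂μ := by simp only [eLpNorm_two_sq]
    _ = ∫⁻ t, ∑ i, ‖f i t‖ₑ ^ 2 ∂μ := by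
        rw [lintegral_finsetSum']
        intro i _
        exact ((f i).aestronglyMeasurable.enorm).pow_const 2
    _ ≤ ∫⁻ _, ENNReal.ofReal (C ^ 2) ∂μ := by
        apply lintegral_mono_ae
        filter_upwards [h6] with t ht
        have : ∀ i, ‖f i t‖ₑ ^ 2 = ENNReal.ofReal (f i t ^ 2) := by
          intro i
          rw [← ofReal_norm, ← ENNReal.ofReal_pow (norm_nonneg _), Real.norm_eq_abs, sq_abs]
        simp only [this]
        rw [← ENNReal.ofReal_sum_of_nonneg (fun _ _ => sq_nonneg _)]
        exact ENNReal.ofReal_le_ofReal ht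
    _ = ENNReal.ofReal (C ^ 2) := by simp

lemma exists_orthonormal_comp {V H : Type*} [AddCommGroup V] [Module ℝ V]
    [NormedAddCommGroup H] [InnerProductSpace ℝ H] {N : ℕ} (hN : (N : Cardinal) ≤ Module.rank ℝ V)
    (Φ : V →ₗ[ℝ] H) (hΦ : Function.Injective Φ) :
    ∃ g : Fin N → V, Orthonormal ℝ (Φ ∘ g) := by
  obtain ⟨v, hv⟩ := Module.le_rank_iff.1 hN
  have hli : LinearIndependent ℝ (Φ ∘ v) := hv.map' Φ (LinearMap.ker_eq_bot.2 hΦ)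
  have hmem : ∀ i, ∃ y, Φ y = InnerProductSpace.gramSchmidtNormed ℝ (Φ ∘ v) i := by
    intro i
    have h1 : InnerProductSpace.gramSchmidtNormed ℝ (Φ ∘ v) i ∈
        Submodule.span ℝ (Set.range (InnerProductSpace.gramSchmidtNormed ℝ (Φ ∘ v))) :=
      Submodule.subset_span ⟨i, rfl⟩
    rw [InnerProductSpace.span_gramSchmidtNormed_range, InnerProductSpace.span_gramSchmidt] at h1
    have h2 : Submodule.span ℝ (Set.range (Φ ∘ v)) ≤ LinearMap.range Φ := by
      rw [Submodule.span_le]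
      rintro _ ⟨k, rfl⟩
      exact ⟨v k, rfl⟩
    exact h2 h1
  choose g hg using hmem
  refine ⟨g, ?_⟩
  rw [show Φ ∘ g = InnerProductSpace.gramSchmidtNormed ℝ (Φ ∘ v) from funext hg]
  exact InnerProductSpace.gramSchmidtNormed_orthonormal hli

lemma norm_sum_smul_of_orthonormal {ι H : Type*} [Fintype ι] [NormedAddCommGroup H]
    [InnerProductSpace ℝ H] {e : ι → H} (he : Orthonormal ℝ e) (a : EuclideanSpace ℝ ι) :
    ‖∑ i, a i • e i‖ = ‖a‖ := by
  have h : ‖∑ i, a i • e i‖ ^ 2 = ‖a‖ ^ 2 := by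
    rw [← real_inner_self_eq_norm_sq, he.inner_sum, EuclideanSpace.norm_sq_eq]
    simp [pow_two]
  exact (pow_left_inj₀ (norm_nonneg _) (norm_nonneg _) two_ne_zero).1 h

/-- Restriction of a space of sequences to finitely many coordinates, as a map into the
`ℓ²`-sum of copies of `L²(μ)`. -/
noncomputable def restrictLp {α κ : Type*} [MeasurableSpace α] {μ : Measure α}
    (Z : Submodule ℝ (κ → (α →ₘ[μ] ℝ))) (hZ : ∀ x ∈ Z, ∀ j, eLpNorm (x j) 2 μ < ∞)
    (A : Finset κ) : Z →ₗ[ℝ] PiLp 2 (fun _ : A => Lp ℝ 2 μ) where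
  toFun x := WithLp.toLp 2 fun j => ⟨x.1 j, Lp.mem_Lp_iff_eLpNorm_lt_top.2 (hZ x.1 x.2 j)⟩
  map_add' _ _ := rfl
  map_smul' _ _ := rfl

lemma norm_restrictLp_apply {α κ : Type*} [MeasurableSpace α] {μ : Measure α}
    (Z : Submodule ℝ (κ → (α →ₘ[μ] ℝ))) (hZ : ∀ x ∈ Z, ∀ j, eLpNorm (x j) 2 μ < ∞)
    (A : Finset κ) (x : Z) (j : A) :
    ‖restrictLp Z hZ A x j‖ = (eLpNorm (x.1 j) 2 μ).toReal := rfl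

/-- A subspace of bounded functions of large dimension contains, for every small set `A` of
coordinates, a nonzero vector whose `L²`-norms on `A` are small compared to its sup-norms. -/
lemma exists_ne_zero_eLpNorm_two_le {α κ : Type*} [MeasurableSpace α] {μ : Measure α}
    [IsProbabilityMeasure μ] (Z : Submodule ℝ (κ → (α →ₘ[μ] ℝ)))
    (hZ : ∀ x ∈ Z, ∀ j, eLpNorm (x j) ∞ μ < ∞) {N : ℕ} (hN : (N : Cardinal) ≤ Module.rank ℝ Z)
    (A : Finset κ) {δ : ℝ} (hδ : 0 < δ) (hA : A.card < N * δ ^ 2) :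
    ∃ y ∈ Z, y ≠ 0 ∧ ∀ S : ℝ≥0∞, (∀ k ∈ A, eLpNorm (y k) ∞ μ ≤ S) →
      ∀ j ∈ A, eLpNorm (y j) 2 μ ≤ ENNReal.ofReal δ * S := by
  have hZ2 : ∀ x ∈ Z, ∀ j, eLpNorm (x j) 2 μ < ∞ := fun x hx j =>
    (eLpNorm_le_eLpNorm_of_exponent_le le_top (x j).aestronglyMeasurable).trans_lt (hZ x hx j)
  set Φ := restrictLp Z hZ2 A with hΦdef
  by_cases hΦ : Function.Injective Φ
  swap
  · rw [injective_iff_map_eq_zero] at hΦ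
    push Not at hΦ
    obtain ⟨y, hy, hy0⟩ := hΦ
    refine ⟨y.1, y.2, by simpa using hy0, fun S _ j hj => ?_⟩
    have h1 := norm_restrictLp_apply Z hZ2 A y ⟨j, hj⟩
    rw [← hΦdef, hy] at h1
    have h2 : (eLpNorm (y.1 j) 2 μ).toReal = 0 := by rw [← h1]; simp
    rw [ENNReal.toReal_eq_zero_iff] at h2
    rw [h2.resolve_right (hZ2 y.1 y.2 j).ne]
    exact zero_le
  obtain ⟨g, hg⟩ := exists_orthonormal_comp hN Φ hΦ
  by_contra hcon
  push Not at hcon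
  have hbd : ∀ k ∈ A, ∀ a : EuclideanSpace ℝ (Fin N),
      eLpNorm (∑ i, a i • (g i).1 k : α →ₘ[μ] ℝ) ∞ μ ≤ ENNReal.ofReal (δ⁻¹ * ‖a‖) := by
    intro k hk a
    set Y : Z := ∑ i, a i • g i with hY
    have hYk : ∀ k, Y.1 k = ∑ i, a i • (g i).1 k := by
      intro k
      simp [hY]
    have hnorm : ‖Φ Y‖ = ‖a‖ := by
      rw [hY, map_sum]
      simp only [map_smul]
      exact norm_sum_smul_of_orthonormal hg a
    rw [← hYk]
    by_cases hY0 : Y = 0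
    · rw [hY0]
      simp [eLpNorm_congr_ae AEEqFun.coeFn_zero]
    obtain ⟨S, hS, j, hj, hlt⟩ := hcon Y.1 Y.2 (by simpa using hY0)
    have h1 : eLpNorm (Y.1 j) 2 μ ≤ ENNReal.ofReal ‖a‖ := by
      rw [← ENNReal.ofReal_toReal (hZ2 Y.1 Y.2 j).ne, ← norm_restrictLp_apply Z hZ2 A Y ⟨j, hj⟩,
        ← hnorm]
      exact ENNReal.ofReal_le_ofReal (PiLp.norm_apply_le _ _)
    have h2 : ENNReal.ofReal δ * eLpNorm (Y.1 k) ∞ μ ≤ ENNReal.ofReal ‖a‖ :=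
      ((mul_le_mul_right (hS k hk) _).trans hlt.le).trans h1
    rw [ENNReal.ofReal_mul (by positivity), ENNReal.ofReal_inv_of_pos hδ]
    rw [mul_comm, ← div_eq_mul_inv]
    rw [ENNReal.le_div_iff_mul_le (by simp [hδ]) (by simp), mul_comm]
    exact h2
  have hsum : ∑ k ∈ A, ∑ i, eLpNorm ((g i).1 k) 2 μ ^ 2 ≤ A.card • ENNReal.ofReal (δ⁻¹ ^ 2) :=
    Finset.sum_le_card_nsmul _ _ _ fun k hk =>
      sum_eLpNorm_two_sq_le (fun i => (g i).1 k) (by positivity) (hbd k hk)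
  rw [Finset.sum_comm] at hsum
  have hone : ∀ i, ∑ k ∈ A, eLpNorm ((g i).1 k) 2 μ ^ 2 = 1 := by
    intro i
    have h1 : ‖Φ (g i)‖ ^ 2 = 1 := by
      rw [show ‖Φ (g i)‖ = 1 from hg.1 i]; norm_num
    rw [PiLp.norm_sq_eq_of_L2] at h1
    have h2 : ∀ k : A, eLpNorm ((g i).1 k) 2 μ ^ 2 = ENNReal.ofReal (‖Φ (g i) k‖ ^ 2) := by
      intro k
      rw [ENNReal.ofReal_pow (norm_nonneg _), norm_restrictLp_apply,
        ENNReal.ofReal_toReal (hZ2 _ (g i).2 _).ne]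
    rw [← Finset.sum_coe_sort]
    simp only [h2]
    rw [← ENNReal.ofReal_sum_of_nonneg (fun _ _ => by positivity), h1, ENNReal.ofReal_one]
  simp only [hone] at hsum
  simp only [Finset.sum_const, Finset.card_univ, Fintype.card_fin, nsmul_eq_mul, mul_one] at hsum
  rw [← ENNReal.ofReal_natCast, ← ENNReal.ofReal_natCast, ← ENNReal.ofReal_mul (by positivity),
    ENNReal.ofReal_le_ofReal_iff (by positivity)] at hsum
  have : (N : ℝ) * δ ^ 2 ≤ (A.card : ℝ) := by
    calc (N : ℝ) * δ ^ 2 ≤ ((A.card : ℝ) * δ⁻¹ ^ 2) * δ ^ 2 := by gcongr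
      _ = (A.card : ℝ) := by rw [mul_assoc, ← mul_pow, inv_mul_cancel₀ hδ.ne', one_pow, mul_one]
  linarith

section SequenceNorm

variable {ι : Type*} {q : ℝ≥0∞}

lemma eSeqNorm_rpow (hq₀ : q ≠ 0) (hq : q ≠ ∞) (f : ι → ℝ≥0∞) :
    eSeqNorm q f ^ q.toReal = ∑' i, f i ^ q.toReal := by
  have hr : 0 < q.toReal := ENNReal.toReal_pos hq₀ hq
  rw [eSeqNorm, if_neg hq, ← ENNReal.rpow_mul, one_div_mul_cancel hr.ne', ENNReal.rpow_one]

lemma le_eSeqNorm (hq₀ : q ≠ 0) (hq : q ≠ ∞) (f : ι → ℝ≥0∞) (j : ι) : f j ≤ eSeqNorm q f := by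
  have hr : 0 < q.toReal := ENNReal.toReal_pos hq₀ hq
  rw [← ENNReal.rpow_le_rpow_iff hr, eSeqNorm_rpow hq₀ hq]
  exact ENNReal.le_tsum j

lemma eSeqNorm_mono (q : ℝ≥0∞) {f g : ι → ℝ≥0∞} (h : ∀ i, f i ≤ g i) :
    eSeqNorm q f ≤ eSeqNorm q g := by
  unfold eSeqNorm
  split_ifs
  · exact iSup_mono h
  · refine ENNReal.rpow_le_rpow (ENNReal.tsum_le_tsum fun i => ?_) (by positivity)
    exact ENNReal.rpow_le_rpow (h i) ENNReal.toReal_nonneg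

lemma card_mul_rpow_le_eSeqNorm_rpow (hq₀ : q ≠ 0) (hq : q ≠ ∞) {f : ι → ℝ≥0∞} {c : ℝ≥0∞}
    (T : Finset ι) (hT : ∀ j ∈ T, c ≤ f j) :
    T.card * c ^ q.toReal ≤ eSeqNorm q f ^ q.toReal := by
  rw [eSeqNorm_rpow hq₀ hq, ← nsmul_eq_mul]
  calc T.card • c ^ q.toReal ≤ ∑ j ∈ T, f j ^ q.toReal :=
        Finset.card_nsmul_le_sum _ _ _ fun j hj =>
          ENNReal.rpow_le_rpow (hT j hj) ENNReal.toReal_nonneg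
    _ ≤ _ := ENNReal.sum_le_tsum T

lemma eSeqNorm_const_mul (hq₀ : q ≠ 0) (hq : q ≠ ∞) (c : ℝ≥0∞) (f : ι → ℝ≥0∞) :
    eSeqNorm q (fun j => c * f j) = c * eSeqNorm q f := by
  have hr : 0 < q.toReal := ENNReal.toReal_pos hq₀ hq
  apply ENNReal.rpow_left_injective hr.ne'
  simp only
  rw [ENNReal.mul_rpow_of_nonneg _ _ hr.le, eSeqNorm_rpow hq₀ hq, eSeqNorm_rpow hq₀ hq,
    ← ENNReal.tsum_mul_left]
  simp only [ENNReal.mul_rpow_of_nonneg _ _ hr.le]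

lemma exists_finset_of_eSeqNorm_le_one (hq₀ : q ≠ 0) (hq : q ≠ ∞) {f : ι → ℝ≥0∞}
    (hf : eSeqNorm q f ≤ 1) {δ : ℝ≥0∞} (hδ : δ ≠ 0) :
    ∃ A : Finset ι, A.card * δ ^ q.toReal ≤ 1 ∧ ∀ j, δ < f j → j ∈ A := by
  have hr : 0 < q.toReal := ENNReal.toReal_pos hq₀ hq
  have h1 : ∑' i, f i ^ q.toReal ≤ 1 := by
    rw [← eSeqNorm_rpow hq₀ hq]
    exact ENNReal.rpow_le_one hf hr.le
  obtain ⟨hfin, -⟩ := ENNReal.finset_card_const_le_le_of_tsum_le ENNReal.one_ne_top h1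
    (ε := δ ^ q.toReal) (by simp [hδ, hr.not_gt])
  refine ⟨hfin.toFinset, ?_, fun j hj => ?_⟩
  · refine (card_mul_rpow_le_eSeqNorm_rpow hq₀ hq _ fun j hj => ?_).trans
      (ENNReal.rpow_le_one hf hr.le)
    rw [Set.Finite.mem_toFinset] at hj
    exact (ENNReal.rpow_le_rpow_iff hr).1 hj
  · rw [Set.Finite.mem_toFinset]
    exact ENNReal.rpow_le_rpow hj.le hr.le

/-- Interpolation between `ℓ^{q₀}` and `ℓ^∞`. -/
lemma eSeqNorm_le_rpow_of_le {q₀ q₁ : ℝ≥0∞} (hq₀ : q₀ ≠ 0) (hq : q₀ < q₁) {f : ι → ℝ≥0∞}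
    (hf : eSeqNorm q₀ f ≤ 1) {s : ℝ≥0∞} (hs : ∀ j, f j ≤ s) :
    eSeqNorm q₁ f ≤ s ^ (1 - (q₀ / q₁).toReal) := by
  have hq₀' : q₀ ≠ ∞ := hq.ne_top
  have hr : 0 < q₀.toReal := ENNReal.toReal_pos hq₀ hq₀'
  by_cases hq₁ : q₁ = ∞
  · simp only [hq₁, eSeqNorm, if_true, ENNReal.div_top, ENNReal.toReal_zero, sub_zero,
      ENNReal.rpow_one]
    exact iSup_le hs
  have hlt : q₀.toReal < q₁.toReal := (ENNReal.toReal_lt_toReal hq₀' hq₁).2 hq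
  have hr₁ : 0 < q₁.toReal := hr.trans hlt
  rw [← ENNReal.rpow_le_rpow_iff hr₁, eSeqNorm_rpow hq.ne_bot hq₁, ← ENNReal.rpow_mul,
    ENNReal.toReal_div, sub_mul, one_mul, div_mul_cancel₀ _ hr₁.ne']
  calc ∑' i, f i ^ q₁.toReal = ∑' i, f i ^ (q₁.toReal - q₀.toReal) * f i ^ q₀.toReal := by
        congr 1 with i
        rw [← ENNReal.rpow_add_of_nonneg _ _ (sub_nonneg.2 hlt.le) hr.le, sub_add_cancel]
    _ ≤ ∑' i, s ^ (q₁.toReal - q₀.toReal) * f i ^ q₀.toReal := by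
        refine ENNReal.tsum_le_tsum fun i => ?_
        gcongr
        exact hs i
    _ = s ^ (q₁.toReal - q₀.toReal) * eSeqNorm q₀ f ^ q₀.toReal := by
        rw [ENNReal.tsum_mul_left, eSeqNorm_rpow hq₀ hq₀']
    _ ≤ s ^ (q₁.toReal - q₀.toReal) * 1 := by
        gcongr
        exact ENNReal.rpow_le_one hf hr.le
    _ = _ := mul_one _

end SequenceNorm

/-- Interpolation between `L²` and `L^∞` on a probability space. -/
lemma eLpNorm_le_rpow_of_eLpNorm_two_le {α : Type*} [MeasurableSpace α] {μ : Measure α}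
    [IsProbabilityMeasure μ] {f : α → ℝ} (hf : AEStronglyMeasurable f μ) {p : ℝ≥0∞} (hp : p ≠ ∞)
    (htop : eLpNorm f ∞ μ ≤ 1) {η : ℝ≥0∞} (h2 : eLpNorm f 2 μ ≤ η) :
    eLpNorm f p μ ≤ η ^ (2 / (max p 2).toReal) := by
  refine (eLpNorm_le_eLpNorm_of_exponent_le (le_max_left p 2) hf).trans ?_
  set r := (max p 2).toReal with hr
  have hmax : max p 2 ≠ ∞ := by simp [hp]
  have hmax0 : max p 2 ≠ 0 := by simp
  have hr2 : 2 ≤ r := by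
    have := ENNReal.toReal_mono hmax (le_max_right p 2)
    simpa using this
  have hr0 : 0 < r := by linarith
  rw [← ENNReal.rpow_le_rpow_iff hr0, ← ENNReal.rpow_mul, div_mul_cancel₀ _ hr0.ne',
    eLpNorm_eq_lintegral_rpow_enorm_toReal hmax0 hmax, ← hr, ← ENNReal.rpow_mul,
    one_div_mul_cancel hr0.ne', ENNReal.rpow_one]
  rw [eLpNorm_exponent_top] at htop
  calc ∫⁻ t, ‖f t‖ₑ ^ r ∂μ ≤ ∫⁻ t, ‖f t‖ₑ ^ (2 : ℝ) ∂μ := by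
        apply lintegral_mono_ae
        filter_upwards [ae_le_eLpNormEssSup (μ := μ) (f := f)] with t ht
        exact ENNReal.rpow_le_rpow_of_exponent_ge (ht.trans htop) hr2
    _ = eLpNorm f 2 μ ^ (2 : ℝ) := by
        rw [eLpNorm_eq_lintegral_rpow_enorm_toReal (by norm_num) (by norm_num), ← ENNReal.rpow_mul]
        simp
    _ ≤ η ^ (2 : ℝ) := ENNReal.rpow_le_rpow h2 (by norm_num)

/-- Gliding hump: if every `x` is large on few coordinates only, and for every small set of
coordinates there is a `y` small on it, then there are `n` vectors with almost disjoint humps. -/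
lemma exists_almost_disjoint {V κ : Type*} [Nonempty V] {P : V → Prop} {a b : V → κ → ℝ≥0∞}
    (hab : ∀ x j, b x j ≤ a x j) {δ : ℝ≥0∞} {n M : ℕ}
    (hA : ∀ x, P x → ∃ A : Finset κ, A.card ≤ M ∧ ∀ j, δ < a x j → j ∈ A)
    (hy : ∀ A : Finset κ, A.card ≤ n * M → ∃ y, P y ∧ ∀ j ∈ A, b y j ≤ δ) :
    ∃ x : ℕ → V, (∀ i < n, P (x i)) ∧
      ∀ i < n, ∀ i' < n, ∀ j, δ < b (x i) j → δ < b (x i') j → i = i' := by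
  classical
  suffices h : ∀ k ≤ n, ∃ x : ℕ → V, (∀ i < k, P (x i)) ∧
      ∀ i' < k, ∀ i < i', ∀ j, δ < a (x i) j → b (x i') j ≤ δ by
    obtain ⟨x, hx, hx'⟩ := h n le_rfl
    refine ⟨x, hx, fun i hi i' hi' j h1 h2 => ?_⟩
    rcases lt_trichotomy i i' with h | h | h
    · exact absurd (hx' i' hi' i h j (h1.trans_le (hab _ _))) h2.not_ge
    · exact h
    · exact absurd (hx' i hi i' h j (h2.trans_le (hab _ _))) h1.not_ge
  intro k
  induction k with
  | zero => exact fun _ => ⟨fun _ => Classical.arbitrary V, by simp, by simp⟩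
  | succ k ih =>
    intro hk
    obtain ⟨x, hx, hx'⟩ := ih (by omega)
    have hA' : ∀ i, ∃ A : Finset κ, A.card ≤ M ∧ (i < k → ∀ j, δ < a (x i) j → j ∈ A) := by
      intro i
      by_cases hi : i < k
      · obtain ⟨A, h1, h2⟩ := hA (x i) (hx i hi)
        exact ⟨A, h1, fun _ => h2⟩
      · exact ⟨∅, by simp, fun h => absurd h hi⟩
    choose A hAM hA' using hA'
    obtain ⟨y, hPy, hyA⟩ := hy ((Finset.range k).biUnion A) <| by
      refine (Finset.card_biUnion_le_card_mul _ _ M fun i _ => hAM i).trans ?_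
      rw [Finset.card_range]
      exact Nat.mul_le_mul_right _ (by omega)
    refine ⟨Function.update x k y, fun i hi => ?_, fun i' hi' i hi j hj => ?_⟩
    · rcases Nat.lt_succ_iff_lt_or_eq.1 hi with h | rfl
      · rw [Function.update_of_ne h.ne]
        exact hx i h
      · rwa [Function.update_self]
    · have hik : i < k := by omega
      rw [Function.update_of_ne hik.ne] at hj
      rcases Nat.lt_succ_iff_lt_or_eq.1 hi' with h | rfl
      · rw [Function.update_of_ne h.ne]
        exact hx' i' h i hi j hj
      · rw [Function.update_self]
        exact hyA j (Finset.mem_biUnion.2 ⟨i, Finset.mem_range.2 hik, hA' i hik j hj⟩)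

lemma sum_erase_le {n : ℕ} {c : ℕ → ℝ≥0∞} {δ : ℝ≥0∞} {k : ℕ}
    (h : ∀ i < n, i ≠ k → c i ≤ δ) : ∑ i ∈ (Finset.range n).erase k, c i ≤ n * δ := by
  calc ∑ i ∈ (Finset.range n).erase k, c i ≤ ((Finset.range n).erase k).card • δ :=
        Finset.sum_le_card_nsmul _ _ _ fun i hi => by
          rw [Finset.mem_erase, Finset.mem_range] at hi
          exact h i hi.2 hi.1
    _ ≤ n * δ := by
        rw [nsmul_eq_mul]
        gcongr
        simpa using Finset.card_erase_le (s := Finset.range n) (a := k)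

section Lp

variable {α κ : Type*} [MeasurableSpace α] {μ : Measure α}

lemma eLpNorm_coe_smul (c : ℝ) (f : α →ₘ[μ] ℝ) (p : ℝ≥0∞) :
    eLpNorm (c • f : α →ₘ[μ] ℝ) p μ = ‖c‖ₑ * eLpNorm f p μ := by
  rw [eLpNorm_congr_ae (AEEqFun.coeFn_smul c f), eLpNorm_const_smul]

lemma eLpNorm_coe_add_le (f g : α →ₘ[μ] ℝ) {p : ℝ≥0∞} (hp : 1 ≤ p) :
    eLpNorm (f + g : α →ₘ[μ] ℝ) p μ ≤ eLpNorm f p μ + eLpNorm g p μ := by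
  rw [eLpNorm_congr_ae (AEEqFun.coeFn_add f g)]
  exact eLpNorm_add_le f.aestronglyMeasurable g.aestronglyMeasurable hp

lemma eLpNorm_coe_sub_le (f g : α →ₘ[μ] ℝ) {p : ℝ≥0∞} (hp : 1 ≤ p) :
    eLpNorm (f - g : α →ₘ[μ] ℝ) p μ ≤ eLpNorm f p μ + eLpNorm g p μ := by
  rw [eLpNorm_congr_ae (AEEqFun.coeFn_sub f g)]
  exact eLpNorm_sub_le f.aestronglyMeasurable g.aestronglyMeasurable hp

lemma eLpNorm_coe_sum_le {ι : Type*} (s : Finset ι) (f : ι → (α →ₘ[μ] ℝ)) {p : ℝ≥0∞}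
    (hp : 1 ≤ p) : eLpNorm (∑ i ∈ s, f i : α →ₘ[μ] ℝ) p μ ≤ ∑ i ∈ s, eLpNorm (f i) p μ :=
  Finset.le_sum_of_subadditive (fun f : α →ₘ[μ] ℝ => eLpNorm f p μ)
    (by simp [eLpNorm_congr_ae AEEqFun.coeFn_zero]) (fun f g => eLpNorm_coe_add_le f g hp) s f

lemma eSeqNorm_eLpNorm_smul {q : ℝ≥0∞} (hq₀ : q ≠ 0) (hq : q ≠ ∞) (c : ℝ)
    (x : κ → (α →ₘ[μ] ℝ)) (p : ℝ≥0∞) :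
    eSeqNorm q (fun j => eLpNorm ((c • x) j) p μ) =
      ‖c‖ₑ * eSeqNorm q fun j => eLpNorm (x j) p μ := by
  rw [← eSeqNorm_const_mul hq₀ hq]
  congr 1 with j
  exact eLpNorm_coe_smul c (x j) p

lemma eSeqNorm_eLpNorm_ne_zero {q : ℝ≥0∞} (hq₀ : q ≠ 0) (hq : q ≠ ∞)
    {x : κ → (α →ₘ[μ] ℝ)} (hx : x ≠ 0) {p : ℝ≥0∞} (hp : p ≠ 0) :
    eSeqNorm q (fun j => eLpNorm (x j) p μ) ≠ 0 := by
  contrapose! hx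
  ext1 j
  have h1 := le_eSeqNorm hq₀ hq (fun j => eLpNorm (x j) p μ) j
  rw [hx, nonpos_iff_eq_zero, eLpNorm_eq_zero_iff (x j).aestronglyMeasurable hp] at h1
  exact AEEqFun.ext (h1.trans AEEqFun.coeFn_zero.symm)

lemma exists_normalizing_scalar {q : ℝ≥0∞} (hq₀ : q ≠ 0) (hq : q ≠ ∞)
    {x : κ → (α →ₘ[μ] ℝ)} {p : ℝ≥0∞}
    (h₀ : eSeqNorm q (fun j => eLpNorm (x j) p μ) ≠ 0)
    (h : eSeqNorm q (fun j => eLpNorm (x j) p μ) ≠ ∞) :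
    ∃ c : ℝ, ‖c‖ₑ = (eSeqNorm q fun j => eLpNorm (x j) p μ)⁻¹ ∧
      eSeqNorm q (fun j => eLpNorm ((c • x) j) p μ) = 1 := by
  set S := eSeqNorm q (fun j => eLpNorm (x j) p μ) with hS
  have hc : ‖S.toReal⁻¹‖ₑ = S⁻¹ := by
    rw [← ofReal_norm, Real.norm_of_nonneg (by positivity),
      ENNReal.ofReal_inv_of_pos (ENNReal.toReal_pos h₀ h), ENNReal.ofReal_toReal h]
  refine ⟨S.toReal⁻¹, hc, ?_⟩
  rw [eSeqNorm_eLpNorm_smul hq₀ hq, hc, ENNReal.inv_mul_cancel h₀ h]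

end Lp

/-- Subspaces of `ℓ^q(L^∞)` of large dimension contain normalized vectors all of whose coordinates
have small `L²`-norm. -/
lemma exists_eSeqNorm_eq_one_eLpNorm_two_le {α κ : Type*} [MeasurableSpace α] (μ : Measure α)
    [IsProbabilityMeasure μ] {q : ℝ≥0∞} (hq₀ : q ≠ 0) (hq : q ≠ ∞) {η : ℝ} (hη : 0 < η) :
    ∃ N : ℕ, ∀ Z : Submodule ℝ (κ → (α →ₘ[μ] ℝ)),
      (∀ x ∈ Z, eSeqNorm q (fun j => eLpNorm (x j) ∞ μ) ≠ ∞) →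
      (N : Cardinal) ≤ Module.rank ℝ Z →
      ∃ x ∈ Z, eSeqNorm q (fun j => eLpNorm (x j) ∞ μ) = 1 ∧
        ∀ j, eLpNorm (x j) 2 μ ≤ ENNReal.ofReal η := by
  classical
  set r := q.toReal with hr_def
  have hr : 0 < r := ENNReal.toReal_pos hq₀ hq
  obtain ⟨n, hn⟩ := exists_nat_gt ((2 / η) ^ r / (η / 2) ^ r)
  have hn0 : (0 : ℝ) < n := lt_trans (by positivity) hn
  rw [div_lt_iff₀ (by positivity)] at hn
  obtain ⟨δ, hδ, hδ1, hδη⟩ : ∃ δ : ℝ, 0 < δ ∧ n * δ ≤ 1 ∧ n * δ ≤ η / 2 := by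
    refine ⟨min 1 (η / 2) / n, by positivity, ?_, ?_⟩ <;> rw [mul_div_cancel₀ _ hn0.ne']
    exacts [min_le_left _ _, min_le_right _ _]
  have hδη' : δ ≤ η := by
    have h1 : (1 : ℝ) ≤ n := by
      have : 0 < n := by exact_mod_cast hn0
      exact_mod_cast this
    nlinarith
  obtain ⟨M, hM⟩ := exists_nat_gt (1 / δ ^ r)
  rw [div_lt_iff₀ (by positivity)] at hM
  obtain ⟨N, hN⟩ := exists_nat_gt ((n * M : ℝ) / δ ^ 2)
  rw [div_lt_iff₀ (by positivity)] at hN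
  refine ⟨N, fun Z hZ hrank => ?_⟩
  by_contra! hcon
  set S : (κ → (α →ₘ[μ] ℝ)) → ℝ≥0∞ := fun x => eSeqNorm q fun j => eLpNorm (x j) ∞ μ with hS_def
  have hle_S : ∀ x j, eLpNorm (x j) ∞ μ ≤ S x := fun x j =>
    le_eSeqNorm hq₀ hq (fun j => eLpNorm (x j) ∞ μ) j
  have h2top : ∀ (x : κ → (α →ₘ[μ] ℝ)) j, eLpNorm (x j) 2 μ ≤ eLpNorm (x j) ∞ μ := fun x j =>
    eLpNorm_le_eLpNorm_of_exponent_le le_top (x j).aestronglyMeasurable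
  have hZfin : ∀ x ∈ Z, ∀ j, eLpNorm (x j) ∞ μ < ∞ := fun x hx j =>
    (hle_S x j).trans_lt (hZ x hx).lt_top
  obtain ⟨x, hx, hdisj⟩ := exists_almost_disjoint (P := fun x => x ∈ Z ∧ S x = 1)
    (a := fun x j => eLpNorm (x j) ∞ μ) (b := fun x j => eLpNorm (x j) 2 μ)
    (δ := ENNReal.ofReal δ) (n := n) (M := M) h2top
    (by
      rintro x ⟨-, hx⟩
      obtain ⟨A, hA, hA'⟩ := exists_finset_of_eSeqNorm_le_one hq₀ hq hx.le
        (δ := ENNReal.ofReal δ) (by simpa using hδ)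
      refine ⟨A, ?_, hA'⟩
      rw [ENNReal.ofReal_rpow_of_pos hδ, ← ENNReal.ofReal_natCast,
        ← ENNReal.ofReal_mul (by positivity), ← ENNReal.ofReal_one,
        ENNReal.ofReal_le_ofReal_iff zero_le_one] at hA
      have : (A.card : ℝ) < M :=
        lt_of_mul_lt_mul_right (hA.trans_lt hM) (by positivity)
      exact_mod_cast this.le)
    (by
      intro A hA
      have hA' : (A.card : ℝ) < N * δ ^ 2 :=
        lt_of_le_of_lt (by exact_mod_cast hA) hN
      obtain ⟨y, hyZ, hy0, hy⟩ := exists_ne_zero_eLpNorm_two_le Z hZfin hrank A hδ hA'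
      have hSy0 : S y ≠ 0 := eSeqNorm_eLpNorm_ne_zero hq₀ hq hy0 (by simp)
      obtain ⟨c, hc, hc1⟩ := exists_normalizing_scalar hq₀ hq hSy0 (hZ y hyZ)
      refine ⟨c • y, ⟨Z.smul_mem c hyZ, hc1⟩, fun j hj => ?_⟩
      calc eLpNorm ((c • y) j) 2 μ = ‖c‖ₑ * eLpNorm (y j) 2 μ := eLpNorm_coe_smul c (y j) 2
        _ ≤ (S y)⁻¹ * (ENNReal.ofReal δ * S y) := by
            rw [hc]
            gcongr
            exact hy (S y) (fun k _ => hle_S y k) j hj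
        _ = ENNReal.ofReal δ := by
            rw [mul_comm, mul_assoc, ENNReal.mul_inv_cancel hSy0 (hZ y hyZ), mul_one])
  have hpeak : ∀ i, ∃ j, i < n → ENNReal.ofReal η < eLpNorm (x i j) 2 μ := by
    intro i
    by_cases hi : i < n
    · obtain ⟨j, hj⟩ := hcon (x i) (hx i hi).1 (hx i hi).2
      exact ⟨j, fun _ => hj⟩
    · have hn' : 0 < n := by exact_mod_cast hn0
      obtain ⟨j, -⟩ := hcon (x 0) (hx 0 hn').1 (hx 0 hn').2
      exact ⟨j, fun h => absurd h hi⟩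
  choose J hJ using hpeak
  have hJδ : ∀ i < n, ENNReal.ofReal δ < eLpNorm (x i (J i)) 2 μ := fun i hi =>
    (ENNReal.ofReal_le_ofReal hδη').trans_lt (hJ i hi)
  have hother : ∀ i < n, ∀ j, ENNReal.ofReal δ < eLpNorm (x i j) 2 μ →
      ∑ k ∈ (Finset.range n).erase i, eLpNorm (x k j) 2 μ ≤ ENNReal.ofReal (n * δ) := by
    intro i hi j hij
    rw [ENNReal.ofReal_mul hn0.le, ENNReal.ofReal_natCast]
    refine sum_erase_le fun k hk hki => ?_
    by_contra! h
    exact hki (hdisj k hk i hi j h hij)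
  set z := ∑ i ∈ Finset.range n, x i with hz_def
  have hzZ : z ∈ Z := Z.sum_mem fun i hi => (hx i (Finset.mem_range.1 hi)).1
  have hz_apply : ∀ j, z j = ∑ i ∈ Finset.range n, x i j := fun j => by
    rw [hz_def, Finset.sum_apply]
  have hz_le : ∀ j, eLpNorm (z j) 2 μ ≤ 2 := by
    intro j
    rw [hz_apply]
    refine (eLpNorm_coe_sum_le _ _ one_le_two).trans ?_
    have hnδ : ENNReal.ofReal (n * δ) ≤ 1 := ENNReal.ofReal_le_one.2 hδ1
    by_cases h : ∃ i < n, ENNReal.ofReal δ < eLpNorm (x i j) 2 μ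
    · obtain ⟨i, hi, hij⟩ := h
      rw [← Finset.add_sum_erase _ _ (Finset.mem_range.2 hi)]
      refine (add_le_add ?_ ((hother i hi j hij).trans hnδ)).trans one_add_one_eq_two.le
      exact ((h2top _ _).trans (hle_S _ _)).trans (hx i hi).2.le
    · push Not at h
      calc ∑ i ∈ Finset.range n, eLpNorm (x i j) 2 μ
          ≤ (Finset.range n).card • ENNReal.ofReal δ :=
            Finset.sum_le_card_nsmul _ _ _ fun i hi => h i (Finset.mem_range.1 hi)
        _ = ENNReal.ofReal (n * δ) := by
            rw [Finset.card_range, nsmul_eq_mul, ENNReal.ofReal_mul hn0.le,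
              ENNReal.ofReal_natCast]
        _ ≤ 2 := hnδ.trans one_le_two
  have hz_ge : ∀ i < n, ENNReal.ofReal (η / 2) ≤ eLpNorm (z (J i)) ∞ μ := by
    intro i hi
    refine le_trans ?_ (h2top _ _)
    have hsub : x i (J i) = z (J i) - ∑ k ∈ (Finset.range n).erase i, x k (J i) := by
      rw [hz_apply, ← Finset.add_sum_erase _ _ (Finset.mem_range.2 hi), add_sub_cancel_right]
    have h1 : ENNReal.ofReal η ≤ eLpNorm (z (J i)) 2 μ + ENNReal.ofReal (η / 2) := by
      refine (hJ i hi).le.trans ?_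
      rw [hsub]
      refine (eLpNorm_coe_sub_le _ _ one_le_two).trans ?_
      gcongr
      refine (eLpNorm_coe_sum_le _ _ one_le_two).trans ?_
      exact (hother i hi (J i) (hJδ i hi)).trans (ENNReal.ofReal_le_ofReal hδη)
    have h2 : ENNReal.ofReal η = ENNReal.ofReal (η / 2) + ENNReal.ofReal (η / 2) := by
      rw [← ENNReal.ofReal_add (by positivity) (by positivity), add_halves]
    rw [h2] at h1
    exact ENNReal.le_of_add_le_add_right ENNReal.ofReal_ne_top h1
  have hJinj : Set.InjOn J (Finset.range n) := by
    intro i hi i' hi' h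
    rw [Finset.coe_range, Set.mem_Iio] at hi hi'
    exact hdisj i hi i' hi' (J i) (hJδ i hi) (h ▸ hJδ i' hi')
  have hSz : ENNReal.ofReal (2 / η) ≤ S z := by
    rw [← ENNReal.rpow_le_rpow_iff hr]
    refine le_trans ?_ (card_mul_rpow_le_eSeqNorm_rpow hq₀ hq (c := ENNReal.ofReal (η / 2))
      ((Finset.range n).image J) ?_)
    · rw [Finset.card_image_of_injOn hJinj, Finset.card_range, ← hr_def,
        ENNReal.ofReal_rpow_of_pos (by positivity), ENNReal.ofReal_rpow_of_pos (by positivity),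
        ← ENNReal.ofReal_natCast, ← ENNReal.ofReal_mul hn0.le]
      exact ENNReal.ofReal_le_ofReal hn.le
    · intro j hj
      obtain ⟨i, hi, rfl⟩ := Finset.mem_image.1 hj
      exact hz_ge i (Finset.mem_range.1 hi)
  have hSz0 : S z ≠ 0 := fun h => by
    rw [h, nonpos_iff_eq_zero, ENNReal.ofReal_eq_zero] at hSz
    exact absurd hSz (not_le.2 (by positivity))
  obtain ⟨c, hc, hc1⟩ := exists_normalizing_scalar hq₀ hq hSz0 (hZ z hzZ)
  obtain ⟨j, hj⟩ := hcon (c • z) (Z.smul_mem c hzZ) hc1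
  refine absurd hj (not_lt.2 ?_)
  calc eLpNorm ((c • z) j) 2 μ = ‖c‖ₑ * eLpNorm (z j) 2 μ := eLpNorm_coe_smul c (z j) 2
    _ ≤ (ENNReal.ofReal (2 / η))⁻¹ * ENNReal.ofReal 2 := by
        rw [hc]
        gcongr
        simpa using hz_le j
    _ = ENNReal.ofReal η := by
        rw [← ENNReal.ofReal_inv_of_pos (by positivity), ← ENNReal.ofReal_mul (by positivity)]
        congr 1
        field_simp

instance : IsProbabilityMeasure mu := ⟨by simp [mu]⟩

theorem statement3 (p q₀ q₁ : ℝ≥0∞) (hp₀ : 0 < p) (hp : p ≠ ∞)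
    (hq₀ : 0 < q₀) (hq : q₀ < q₁) :
    FinStrictlySingular
      (fun x : ℕ → (ℝ →ₘ[mu] ℝ) => eSeqNorm q₀ fun j => eLpNorm (x j) ∞ mu)
      (fun x : ℕ → (ℝ →ₘ[mu] ℝ) => eSeqNorm q₁ fun j => eLpNorm (x j) p mu)
      LinearMap.id := by
  have hq₀' : q₀ ≠ ∞ := hq.ne_top
  have hθ₁ : 0 < 2 / (max p 2).toReal :=
    div_pos two_pos (ENNReal.toReal_pos (by simp) (by simp [hp]))
  have hθ₂ : 0 < 1 - (q₀ / q₁).toReal := by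
    have h : q₀ / q₁ < 1 := by
      rw [ENNReal.div_lt_iff (.inl hq.ne_bot) (.inr hq₀'), one_mul]
      exact hq
    have := ENNReal.toReal_strict_mono ENNReal.one_ne_top h
    rw [ENNReal.toReal_one] at this
    linarith
  set θ := 2 / (max p 2).toReal * (1 - (q₀ / q₁).toReal) with hθ_def
  have hθ : 0 < θ := mul_pos hθ₁ hθ₂
  intro ε hε
  obtain ⟨N, hN⟩ := exists_eSeqNorm_eq_one_eLpNorm_two_le (κ := ℕ) mu hq₀.ne' hq₀'
    (η := ε ^ (1 / θ)) (by positivity)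
  refine ⟨N, fun Z hZ hrank => ?_⟩
  obtain ⟨x, hxZ, hx1, hx2⟩ := hN Z hZ hrank
  refine ⟨x, hxZ, hx1, ?_⟩
  have hp1 : ∀ j, eLpNorm (x j) p mu ≤ eLpNorm (x j) ∞ mu := fun j =>
    eLpNorm_le_eLpNorm_of_exponent_le le_top (x j).aestronglyMeasurable
  have htop : ∀ j, eLpNorm (x j) ∞ mu ≤ 1 := fun j =>
    (le_eSeqNorm hq₀.ne' hq₀' (fun j => eLpNorm (x j) ∞ mu) j).trans hx1.le
  have hle : eSeqNorm q₀ (fun j => eLpNorm (x j) p mu) ≤ 1 :=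
    (eSeqNorm_mono q₀ hp1).trans hx1.le
  refine (eSeqNorm_le_rpow_of_le hq₀.ne' hq hle fun j =>
    eLpNorm_le_rpow_of_eLpNorm_two_le (x j).aestronglyMeasurable hp (htop j) (hx2 j)).trans ?_
  rw [← ENNReal.rpow_mul, ← hθ_def, ENNReal.ofReal_rpow_of_pos (by positivity),
    ← Real.rpow_mul hε.le, one_div_mul_cancel hθ.ne', Real.rpow_one]

end Stmt3
end

section
/- Let 0 < p_0 < p_1 ≤ ∞ and 0 < q_0 < q_1 ≤ ∞, and set θ = max(q_0/q_1, p_0/p_1) ∈ (0,1) (with the convention q_0/∞ = p_0/∞ = 0). Then for every double sequence x = (x_{j,k})_{j,k≥0} one has ‖x‖_{ℓ^{q_1}(ℓ^{p_1})} ≤ ‖x‖_{ℓ^{q_0}(ℓ^{p_0})}^{θ} · (sup_{j,k} |x_{j,k}|)^{1−θ}. -/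
/-!
STATEMENT 4: Let 0 < p₀ < p₁ ≤ ∞ and 0 < q₀ < q₁ ≤ ∞, and
θ = max(q₀/q₁, p₀/p₁) (with the convention a/∞ = 0).  Then for every double
sequence x,
  ‖x‖_{ℓ^{q₁}(ℓ^{p₁})} ≤ ‖x‖_{ℓ^{q₀}(ℓ^{p₀})}^θ · (sup_{j,k} |x_{j,k}|)^{1−θ}.
-/

open scoped ENNReal

namespace Stmt4

/-- The `ℓ^q`-norm of a family of extended-nonnegative numbers. -/
noncomputable def eSeqNorm {ι : Type*} (q : ℝ≥0∞) (f : ι → ℝ≥0∞) : ℝ≥0∞ :=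
  if q = ∞ then ⨆ i, f i else (∑' i, f i ^ q.toReal) ^ (1 / q.toReal)

/-- The scalar `ℓ^p`-(quasi-)norm of a real sequence. -/
noncomputable def elpNorm {ι : Type*} (p : ℝ≥0∞) (a : ι → ℝ) : ℝ≥0∞ :=
  eSeqNorm p fun i => ENNReal.ofReal |a i|

theorem tsum_rpow_le_rpow_tsum {ι : Type*} (h : ι → ℝ≥0∞) {r : ℝ} (hr : 1 ≤ r) :
    ∑' i, h i ^ r ≤ (∑' i, h i) ^ r := by
  have split (a : ℝ≥0∞) : a ^ r = a * a ^ (r - 1) := by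
    conv_lhs => rw [← add_sub_cancel 1 r]
    rw [ENNReal.rpow_add_of_nonneg _ _ zero_le_one (sub_nonneg.2 hr), ENNReal.rpow_one]
  rw [split, ← ENNReal.tsum_mul_right]
  refine ENNReal.tsum_le_tsum fun i => ?_
  rw [split]
  exact mul_le_mul_right (ENNReal.rpow_le_rpow (ENNReal.le_tsum i) (sub_nonneg.2 hr)) _

theorem le_eSeqNorm {ι : Type*} {q : ℝ≥0∞} (hq : 0 < q) (f : ι → ℝ≥0∞) (i : ι) :
    f i ≤ eSeqNorm q f := by
  unfold eSeqNorm
  split_ifs with h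
  · exact le_iSup f i
  · have hq' : 0 < q.toReal := ENNReal.toReal_pos hq.ne' h
    rw [one_div, ENNReal.le_rpow_inv_iff hq']
    exact ENNReal.le_tsum (f := fun i => f i ^ q.toReal) i

/-- A pointwise bound `f ≤ g ^ t * c` passes to the norms when `q₀ / q₁ ≤ t`. -/
theorem eSeqNorm_le_rpow_mul {ι : Type*} {q₀ q₁ c : ℝ≥0∞} {t : ℝ} (hq₀ : 0 < q₀)
    (hq : q₀ < q₁) (ht : 0 ≤ t) (hqt : q₀ / q₁ ≤ ENNReal.ofReal t) {f g : ι → ℝ≥0∞}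
    (hfg : ∀ i, f i ≤ g i ^ t * c) : eSeqNorm q₁ f ≤ eSeqNorm q₀ g ^ t * c := by
  by_cases h₁ : q₁ = ∞
  · rw [eSeqNorm, if_pos h₁]
    refine iSup_le fun i => (hfg i).trans ?_
    gcongr
    exact le_eSeqNorm hq₀ g i
  have h₀ : q₀ ≠ ∞ := hq.ne_top
  have a₀ : 0 < q₀.toReal := ENNReal.toReal_pos hq₀.ne' h₀
  have a₁ : 0 < q₁.toReal := ENNReal.toReal_pos (hq₀.trans hq).ne' h₁
  have hr : 1 ≤ t * q₁.toReal / q₀.toReal := by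
    have h := ENNReal.toReal_mono ENNReal.ofReal_ne_top hqt
    rw [ENNReal.toReal_div, ENNReal.toReal_ofReal ht, div_le_iff₀ a₁] at h
    rwa [one_le_div a₀]
  rw [eSeqNorm, eSeqNorm, if_neg h₁, if_neg h₀]
  calc (∑' i, f i ^ q₁.toReal) ^ (1 / q₁.toReal)
      ≤ (∑' i, (g i ^ q₀.toReal) ^ (t * q₁.toReal / q₀.toReal) * c ^ q₁.toReal)
          ^ (1 / q₁.toReal) := by
        refine ENNReal.rpow_le_rpow (ENNReal.tsum_le_tsum fun i => ?_) (by positivity)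
        rw [← ENNReal.rpow_mul, mul_div_cancel₀ _ a₀.ne', ENNReal.rpow_mul,
          ← ENNReal.mul_rpow_of_nonneg _ _ a₁.le]
        exact ENNReal.rpow_le_rpow (hfg i) a₁.le
    _ ≤ ((∑' i, g i ^ q₀.toReal) ^ (t * q₁.toReal / q₀.toReal) * c ^ q₁.toReal)
          ^ (1 / q₁.toReal) := by
        rw [ENNReal.tsum_mul_right]
        gcongr
        exact tsum_rpow_le_rpow_tsum _ hr
    _ = ((∑' i, g i ^ q₀.toReal) ^ (1 / q₀.toReal)) ^ t * c := by
        rw [ENNReal.mul_rpow_of_nonneg _ _ (by positivity), ← ENNReal.rpow_mul,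
          ← ENNReal.rpow_mul, ← ENNReal.rpow_mul, mul_one_div_cancel a₁.ne', ENNReal.rpow_one]
        congr 2
        field_simp

theorem statement4 (p₀ p₁ q₀ q₁ : ℝ≥0∞)
    (hp₀ : 0 < p₀) (hp : p₀ < p₁) (hq₀ : 0 < q₀) (hq : q₀ < q₁)
    (x : ℕ → ℕ → ℝ) :
    eSeqNorm q₁ (fun j => elpNorm p₁ (x j))
      ≤ (eSeqNorm q₀ fun j => elpNorm p₀ (x j)) ^ (max (q₀ / q₁) (p₀ / p₁)).toReal
        * (⨆ j, ⨆ k, ENNReal.ofReal |x j k|) ^ (1 - (max (q₀ / q₁) (p₀ / p₁)).toReal) := by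
  have div_lt_one {a b : ℝ≥0∞} (h : a < b) : a / b < 1 :=
    ENNReal.div_lt_of_lt_mul (by rwa [one_mul])
  have hθ : max (q₀ / q₁) (p₀ / p₁) < 1 := max_lt (div_lt_one hq) (div_lt_one hp)
  have hof := ENNReal.ofReal_toReal hθ.ne_top
  have ht₀ : 0 ≤ (max (q₀ / q₁) (p₀ / p₁)).toReal := ENNReal.toReal_nonneg
  have ht₁ : (max (q₀ / q₁) (p₀ / p₁)).toReal ≤ 1 :=
    ENNReal.toReal_le_of_le_ofReal zero_le_one (by simpa using hθ.le)
  refine eSeqNorm_le_rpow_mul hq₀ hq ht₀ (hof.symm ▸ le_max_left _ _) fun j =>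
    eSeqNorm_le_rpow_mul hp₀ hp ht₀ (hof.symm ▸ le_max_right _ _) fun k => ?_
  calc ENNReal.ofReal |x j k|
      = ENNReal.ofReal |x j k| ^ (max (q₀ / q₁) (p₀ / p₁)).toReal
          * ENNReal.ofReal |x j k| ^ (1 - (max (q₀ / q₁) (p₀ / p₁)).toReal) := by
        rw [← ENNReal.rpow_add_of_nonneg _ _ ht₀ (sub_nonneg.2 ht₁), add_sub_cancel,
          ENNReal.rpow_one]
    _ ≤ _ := by
        refine mul_le_mul_right (ENNReal.rpow_le_rpow ?_ (sub_nonneg.2 ht₁)) _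
        exact le_iSup₂ (f := fun j k => ENNReal.ofReal |x j k|) j k

end Stmt4
end

section
/- Let 0 < p_0 < p_1 ≤ ∞ and 0 < q_0 < q_1 ≤ ∞. Then the Bernstein numbers of the natural embedding ℓ^{q_0}(ℓ^{p_0}) ↪ ℓ^{q_1}(ℓ^{p_1}) satisfy b_n(ℓ^{q_0}(ℓ^{p_0}) ↪ ℓ^{q_1}(ℓ^{p_1})) ≤ n^{−min(1/p_0, 1/q_0)(1 − max(q_0/q_1, p_0/p_1))} for every n ≥ 1 (with the conventions q_0/∞ = p_0/∞ = 0). In particular, the embedding ℓ^{q_0}(ℓ^{p_0}) ↪ ℓ^{q_1}(ℓ^{p_1}) is finitely strictly singular. -/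
/-!
STATEMENT 5: Let 0 < p₀ < p₁ ≤ ∞ and 0 < q₀ < q₁ ≤ ∞.  Then the Bernstein
numbers of the natural embedding ℓ^{q₀}(ℓ^{p₀}) ↪ ℓ^{q₁}(ℓ^{p₁}) satisfy
  b_n ≤ n^{−min(1/p₀,1/q₀)(1−max(q₀/q₁, p₀/p₁))}   (n ≥ 1),
with the convention a/∞ = 0.  In particular the embedding is finitely strictly
singular.
-/

open scoped ENNReal

namespace Stmt5

/-- The `ℓ^q`-norm of a family of extended-nonnegative numbers. -/
noncomputable def eSeqNorm {ι : Type*} (q : ℝ≥0∞) (f : ι → ℝ≥0∞) : ℝ≥0∞ :=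
  if q = ∞ then ⨆ i, f i else (∑' i, f i ^ q.toReal) ^ (1 / q.toReal)

/-- The scalar `ℓ^p`-(quasi-)norm of a real sequence. -/
noncomputable def elpNorm {ι : Type*} (p : ℝ≥0∞) (a : ι → ℝ) : ℝ≥0∞ :=
  eSeqNorm p fun i => ENNReal.ofReal |a i|

/-- `T` is finitely strictly singular w.r.t. the (extended-valued) norms `M₀`, `M₁`. -/
def FinStrictlySingular {V₀ V₁ : Type*} [AddCommGroup V₀] [Module ℝ V₀]
    [AddCommGroup V₁] [Module ℝ V₁]
    (M₀ : V₀ → ℝ≥0∞) (M₁ : V₁ → ℝ≥0∞) (T : V₀ →ₗ[ℝ] V₁) : Prop :=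
  ∀ ε : ℝ, 0 < ε → ∃ N : ℕ, ∀ Z : Submodule ℝ V₀, (∀ x ∈ Z, M₀ x ≠ ∞) →
    (N : Cardinal) ≤ Module.rank ℝ Z → ∃ x ∈ Z, M₀ x = 1 ∧ M₁ (T x) ≤ ENNReal.ofReal ε

/-- The `n`-th Bernstein number of `T` w.r.t. the norms `M₀`, `M₁`. -/
noncomputable def bernstein {V₀ V₁ : Type*} [AddCommGroup V₀] [Module ℝ V₀]
    [AddCommGroup V₁] [Module ℝ V₁]
    (M₀ : V₀ → ℝ≥0∞) (M₁ : V₁ → ℝ≥0∞) (T : V₀ →ₗ[ℝ] V₁) (n : ℕ) : ℝ≥0∞ :=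
  ⨆ Z : {Z : Submodule ℝ V₀ // (∀ x ∈ Z, M₀ x ≠ ∞) ∧ (n : Cardinal) ≤ Module.rank ℝ Z},
    ⨅ x : {x : V₀ // x ∈ Z.1 ∧ M₀ x = 1}, M₁ (T x.1)

theorem eSeqNorm_mono {ι : Type*} (q : ℝ≥0∞) {f g : ι → ℝ≥0∞} (h : ∀ i, f i ≤ g i) :
    eSeqNorm q f ≤ eSeqNorm q g := by
  unfold eSeqNorm
  split_ifs
  · exact iSup_mono h
  · gcongr with i
    exact h i

theorem eSeqNorm_const_mul {ι : Type*} {q : ℝ≥0∞} (hq : q ≠ 0) (c : ℝ≥0∞) (f : ι → ℝ≥0∞) :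
    eSeqNorm q (fun i => c * f i) = c * eSeqNorm q f := by
  unfold eSeqNorm
  split_ifs with h
  · rw [ENNReal.mul_iSup]
  · have hpos := ENNReal.toReal_pos hq h
    simp_rw [ENNReal.mul_rpow_of_nonneg _ _ hpos.le, ENNReal.tsum_mul_left]
    rw [ENNReal.mul_rpow_of_nonneg _ _ (by positivity), ← ENNReal.rpow_mul,
      mul_one_div_cancel hpos.ne', ENNReal.rpow_one]

theorem elpNorm_smul {ι : Type*} {p : ℝ≥0∞} (hp : p ≠ 0) (c : ℝ) (a : ι → ℝ) :
    elpNorm p (c • a) = ENNReal.ofReal |c| * elpNorm p a := by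
  unfold elpNorm
  rw [← eSeqNorm_const_mul hp]
  simp [abs_mul, ENNReal.ofReal_mul]

theorem eSeqNorm_elpNorm_smul {ι κ : Type*} {p q : ℝ≥0∞} (hp : p ≠ 0) (hq : q ≠ 0) (c : ℝ)
    (x : ι → κ → ℝ) :
    (eSeqNorm q fun j => elpNorm p ((c • x) j)) =
      ENNReal.ofReal |c| * eSeqNorm q fun j => elpNorm p (x j) := by
  rw [← eSeqNorm_const_mul hq]
  simp [elpNorm_smul hp]

theorem tsum_rpow_le_rpow_tsum {ι : Type*} (f : ι → ℝ≥0∞) {r : ℝ} (hr : 1 ≤ r) :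
    ∑' i, f i ^ r ≤ (∑' i, f i) ^ r := by
  have split (a : ℝ≥0∞) : a ^ r = a * a ^ (r - 1) := by
    conv_rhs => enter [1]; rw [← ENNReal.rpow_one a]
    rw [← ENNReal.rpow_add_of_nonneg _ _ zero_le_one (by linarith)]
    congr 1
    ring
  rw [split (∑' i, f i), ← ENNReal.tsum_mul_right]
  refine ENNReal.tsum_le_tsum fun i => ?_
  rw [split]
  gcongr
  exact ENNReal.le_tsum i

theorem le_eSeqNorm {ι : Type*} {q : ℝ≥0∞} (hq : q ≠ 0) (f : ι → ℝ≥0∞) (i : ι) :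
    f i ≤ eSeqNorm q f := by
  unfold eSeqNorm
  split_ifs with h
  · exact le_iSup f i
  · have hpos := ENNReal.toReal_pos hq h
    rw [one_div, ENNReal.le_rpow_inv_iff hpos]
    exact ENNReal.le_tsum (f := fun i => f i ^ q.toReal) i

theorem eSeqNorm_rpow_le {ι : Type*} {q₀ q₁ : ℝ≥0∞} (h₀ : q₀ ≠ 0) (h₀' : q₀ ≠ ∞)
    (h₁ : q₁ ≠ 0) {θ : ℝ} (hθ : 0 ≤ θ) (h : (q₀ / q₁).toReal ≤ θ) (g : ι → ℝ≥0∞) :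
    eSeqNorm q₁ (fun i => g i ^ θ) ≤ eSeqNorm q₀ g ^ θ := by
  by_cases h₁' : q₁ = ∞
  · rw [eSeqNorm, if_pos h₁']
    exact iSup_le fun i => ENNReal.rpow_le_rpow (le_eSeqNorm h₀ g i) hθ
  have hp₀ := ENNReal.toReal_pos h₀ h₀'
  have hp₁ := ENNReal.toReal_pos h₁ h₁'
  rw [ENNReal.toReal_div, div_le_iff₀ hp₁] at h
  rw [eSeqNorm, eSeqNorm, if_neg h₁', if_neg h₀']
  have key := tsum_rpow_le_rpow_tsum (fun i => g i ^ q₀.toReal)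
    (r := θ * q₁.toReal / q₀.toReal) ((one_le_div hp₀).2 h)
  simp_rw [← ENNReal.rpow_mul, mul_div_cancel₀ _ hp₀.ne'] at key ⊢
  refine (ENNReal.rpow_le_rpow key (by positivity)).trans_eq ?_
  rw [← ENNReal.rpow_mul]
  congr 1
  field_simp

theorem eSeqNorm_anti {ι : Type*} {q₀ q₁ : ℝ≥0∞} (h₀ : q₀ ≠ 0) (h₀' : q₀ ≠ ∞) (h : q₀ ≤ q₁)
    (g : ι → ℝ≥0∞) : eSeqNorm q₁ g ≤ eSeqNorm q₀ g := by
  have := eSeqNorm_rpow_le h₀ h₀' (fun h' => h₀ (le_zero_iff.1 (h' ▸ h))) zero_le_one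
    (ENNReal.toReal_mono ENNReal.one_ne_top (ENNReal.div_le_of_le_mul (by simpa using h))) g
  simpa using this

/-- On sequences bounded by one, the mixed norm interpolates between the smaller mixed norm and
the supremum. -/
theorem eSeqNorm_elpNorm_le_rpow {ι κ : Type*} {p₀ p₁ q₀ q₁ : ℝ≥0∞}
    (hp₀ : p₀ ≠ 0) (hp₀' : p₀ ≠ ∞) (hp₁ : p₁ ≠ 0)
    (hq₀ : q₀ ≠ 0) (hq₀' : q₀ ≠ ∞) (hq₁ : q₁ ≠ 0) {θ : ℝ} (hθ : 0 ≤ θ) (hθ' : θ ≤ 1)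
    (hp : (p₀ / p₁).toReal ≤ θ) (hq : (q₀ / q₁).toReal ≤ θ) (x : ι → κ → ℝ)
    (hx : ∀ j k, |x j k| ≤ 1) :
    (eSeqNorm q₁ fun j => elpNorm p₁ (x j)) ≤ (eSeqNorm q₀ fun j => elpNorm p₀ (x j)) ^ θ := by
  refine (eSeqNorm_mono q₁ fun j => ?_).trans (eSeqNorm_rpow_le hq₀ hq₀' hq₁ hθ hq _)
  refine (eSeqNorm_mono p₁ fun k => ?_).trans (eSeqNorm_rpow_le hp₀ hp₀' hp₁ hθ hp _)
  conv_lhs => rw [← ENNReal.rpow_one (ENNReal.ofReal _)]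
  exact ENNReal.rpow_le_rpow_of_exponent_ge (by simpa using hx j k) hθ'

theorem tsum_prod_rpow_le {ι κ : Type*} {p q : ℝ≥0∞}
    (hp : p ≠ 0) (hp' : p ≠ ∞) (hq : q ≠ 0) (hq' : q ≠ ∞) (x : ι → κ → ℝ) :
    (∑' i : ι × κ, ENNReal.ofReal |x i.1 i.2| ^ (max p q).toReal) ^ (1 / (max p q).toReal) ≤
      eSeqNorm q fun j => elpNorm p (x j) := by
  have hs : max p q ≠ ∞ := by simp [hp', hq']
  have hs0 : max p q ≠ 0 := by simp [hp]
  have hpos := ENNReal.toReal_pos hs0 hs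
  refine le_trans ?_ (eSeqNorm_anti hq hq' (le_max_right p q) _)
  refine le_trans ?_ (eSeqNorm_mono _ fun j => eSeqNorm_anti hp hp' (le_max_left p q) _)
  rw [ENNReal.tsum_prod (f := fun j k => ENNReal.ofReal |x j k| ^ (max p q).toReal)]
  simp only [eSeqNorm, if_neg hs, one_div, ENNReal.rpow_inv_rpow hpos.ne']
  exact le_rfl

/-- A finite-dimensional space of functions tending to zero contains a function of supremum norm
one attaining its norm at as many points as the dimension. -/
theorem exists_abs_eq_one_of_finrank {ι : Type*} (Z : Submodule ℝ (ι → ℝ)) [FiniteDimensional ℝ Z]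
    (hZ : ∀ x ∈ Z, ∀ c : ℝ, 0 < c → {i | c ≤ |x i|}.Finite) :
    ∃ x ∈ Z, (∀ i, |x i| ≤ 1) ∧
      ∃ s : Finset ι, Module.finrank ℝ Z ≤ s.card ∧ ∀ i ∈ s, |x i| = 1 := by
  set B : Set (ι → ℝ) := (Z : Set (ι → ℝ)) ∩ Set.Icc (-1) 1 with hB
  have memB {x : ι → ℝ} : x ∈ B ↔ x ∈ Z ∧ ∀ i, |x i| ≤ 1 := by
    simp only [hB, Set.mem_inter_iff, SetLike.mem_coe, Set.mem_Icc, Pi.le_def, abs_le,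
      Pi.neg_apply, Pi.one_apply, forall_and]
  have hcomp : IsCompact B := isCompact_Icc.inter_left Z.closed_of_finiteDimensional
  obtain ⟨x, hx⟩ := hcomp.extremePoints_nonempty ⟨0, memB.2 ⟨Z.zero_mem, by simp⟩⟩
  obtain ⟨hxB, hext⟩ := mem_extremePoints.1 hx
  obtain ⟨hxZ, hx1⟩ := memB.1 hxB
  have hF : {i | |x i| = 1}.Finite :=
    (hZ x hxZ 1 one_pos).subset fun i (hi : |x i| = 1) => hi.ge
  refine ⟨x, hxZ, hx1, hF.toFinset, ?_, fun i hi => by simpa using hi⟩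
  by_contra! hlt
  set s := hF.toFinset
  let ev : Z →ₗ[ℝ] (s → ℝ) := (LinearMap.funLeft ℝ ℝ ((↑) : s → ι)).comp Z.subtype
  obtain ⟨y, hy, hy0⟩ := (Submodule.ne_bot_iff _).1
    (LinearMap.ker_ne_bot_of_finrank_lt (f := ev) (by simpa using hlt))
  have hyF (i : ι) (hi : |x i| = 1) : (y : ι → ℝ) i = 0 :=
    congrFun (LinearMap.mem_ker.1 hy) (⟨i, by simpa [s] using hi⟩ : s)
  obtain ⟨C, hC, hyC⟩ : ∃ C : ℝ, 0 < C ∧ ∀ i, |(y : ι → ℝ) i| ≤ C := by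
    have hfin := hZ y y.2 1 one_pos
    obtain ⟨C, hC⟩ := (hfin.image fun i => |(y : ι → ℝ) i|).bddAbove
    refine ⟨max C 1, by positivity, fun i => ?_⟩
    by_cases hi : 1 ≤ |(y : ι → ℝ) i|
    · exact (hC ⟨i, hi, rfl⟩).trans (le_max_left _ _)
    · exact (not_le.1 hi).le.trans (le_max_right _ _)
  obtain ⟨δ, hδ, hxδ⟩ : ∃ δ : ℝ, 0 < δ ∧ ∀ i, |x i| ≠ 1 → |x i| + δ ≤ 1 := by
    have hfin : {i | 1 / 2 ≤ |x i| ∧ |x i| ≠ 1}.Finite :=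
      (hZ x hxZ (1 / 2) (by norm_num)).subset fun i hi => hi.1
    rcases hfin.toFinset.eq_empty_or_nonempty with he | hne
    · refine ⟨1 / 2, by norm_num, fun i hi => ?_⟩
      by_contra! h
      exact Finset.notMem_empty i (he ▸ hfin.mem_toFinset.2 ⟨by linarith, hi⟩)
    · obtain ⟨i₀, hi₀, hmax⟩ := hfin.toFinset.exists_max_image (fun i => |x i|) hne
      have h₀ : 1 / 2 ≤ |x i₀| ∧ |x i₀| ≠ 1 := by simpa using hi₀
      refine ⟨1 - |x i₀|, by linarith [lt_of_le_of_ne (hx1 i₀) h₀.2], fun i hi => ?_⟩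
      by_cases h : 1 / 2 ≤ |x i|
      · linarith [hmax i (by simpa using ⟨by simpa using h, hi⟩)]
      · linarith [h₀.1]
  have hmem (ε : ℝ) (hε : |ε| = δ / C) : x + ε • (y : ι → ℝ) ∈ B := by
    refine memB.2 ⟨Z.add_mem hxZ (Z.smul_mem _ y.2), fun i => ?_⟩
    simp only [Pi.add_apply, Pi.smul_apply, smul_eq_mul]
    by_cases hi : |x i| = 1
    · simp [hyF i hi, hi]
    · calc |x i + ε * (y : ι → ℝ) i| ≤ |x i| + |ε| * |(y : ι → ℝ) i| := by
            rw [← abs_mul]; exact abs_add_le _ _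
        _ ≤ |x i| + δ / C * C := by rw [hε]; gcongr; exact hyC i
        _ ≤ 1 := by rw [div_mul_cancel₀ _ hC.ne']; exact hxδ i hi
  have hpos : 0 < δ / C := by positivity
  have := (hext _ (hmem (δ / C) (abs_of_pos hpos)) _
    (hmem (-(δ / C)) (by rw [abs_neg, abs_of_pos hpos]))
    ⟨1 / 2, 1 / 2, by norm_num, by norm_num, by norm_num, by
      ext i; simp; ring⟩).1
  have hzero : (δ / C) • (y : ι → ℝ) = 0 := by simpa using this
  exact hy0 (Subtype.ext ((smul_eq_zero.1 hzero).resolve_left hpos.ne'))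

/-- Every subspace of dimension at least `n` on which the mixed norm is finite contains a vector
bounded by one with at least `n` entries of modulus one. -/
theorem exists_bounded_of_le_rank {p q : ℝ≥0∞} (hp : p ≠ 0) (hp' : p ≠ ∞) (hq : q ≠ 0)
    (hq' : q ≠ ∞) {ι κ : Type*} (Z : Submodule ℝ (ι → κ → ℝ))
    (hZ : ∀ x ∈ Z, (eSeqNorm q fun j => elpNorm p (x j)) ≠ ∞) {n : ℕ}
    (hn : (n : Cardinal) ≤ Module.rank ℝ Z) :
    ∃ x ∈ Z, (∀ j k, |x j k| ≤ 1) ∧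
      ∃ s : Finset (ι × κ), n ≤ s.card ∧ ∀ i ∈ s, |x i.1 i.2| = 1 := by
  have hs : max p q ≠ ∞ := by simp [hp', hq']
  have hs0 : max p q ≠ 0 := by simp [hp]
  have hpos := ENNReal.toReal_pos hs0 hs
  obtain ⟨f, hf⟩ := Module.le_rank_iff_exists_linearMap.1 hn
  let g : (Fin n → ℝ) →ₗ[ℝ] (ι × κ → ℝ) :=
    (LinearEquiv.curry ℝ ℝ ι κ).symm.toLinearMap ∘ₗ Z.subtype ∘ₗ f
  have hg : Function.Injective g :=
    (LinearEquiv.curry ℝ ℝ ι κ).symm.injective.comp (Z.injective_subtype.comp hf)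
  obtain ⟨x, ⟨v, rfl⟩, hx1, s, hcard, hxs⟩ := exists_abs_eq_one_of_finrank (LinearMap.range g) (by
    rintro _ ⟨v, rfl⟩ c hc
    have hfin : ∑' i : ι × κ,
        ENNReal.ofReal |(f v : ι → κ → ℝ) i.1 i.2| ^ (max p q).toReal ≠ ∞ := by
      intro h
      have := tsum_prod_rpow_le hp hp' hq hq' (f v : ι → κ → ℝ)
      rw [h, ENNReal.top_rpow_of_pos (by positivity)] at this
      exact hZ _ (f v).2 (top_le_iff.1 this)
    refine (ENNReal.finite_const_le_of_tsum_ne_top hfin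
      (ε := ENNReal.ofReal c ^ (max p q).toReal) (by
        simp [ENNReal.rpow_eq_zero_iff, hc, not_lt.2 hpos.le])).subset fun i hi => ?_
    exact ENNReal.rpow_le_rpow (ENNReal.ofReal_le_ofReal hi) hpos.le)
  rw [LinearMap.finrank_range_of_inj hg, Module.finrank_fin_fun] at hcard
  exact ⟨f v, (f v).2, fun j k => hx1 (j, k), s, hcard, hxs⟩

theorem rpow_le_eSeqNorm_elpNorm {ι κ : Type*} {p q : ℝ≥0∞}
    (hp : p ≠ 0) (hp' : p ≠ ∞) (hq : q ≠ 0) (hq' : q ≠ ∞) (x : ι → κ → ℝ)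
    (s : Finset (ι × κ)) (hs : ∀ i ∈ s, |x i.1 i.2| = 1) :
    (s.card : ℝ≥0∞) ^ min p.toReal⁻¹ q.toReal⁻¹ ≤ eSeqNorm q fun j => elpNorm p (x j) := by
  have hp0 := ENNReal.toReal_pos hp hp'
  have hq0 := ENNReal.toReal_pos hq hq'
  have hexp : min p.toReal⁻¹ q.toReal⁻¹ = 1 / (max p q).toReal := by
    rw [ENNReal.toReal_max hp' hq', one_div]
    rcases le_total p.toReal q.toReal with h | h
    · rw [max_eq_right h, min_eq_right (inv_anti₀ hp0 h)]
    · rw [max_eq_left h, min_eq_left (inv_anti₀ hq0 h)]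
  rw [hexp]
  refine le_trans ?_ (tsum_prod_rpow_le hp hp' hq hq' x)
  gcongr
  refine le_trans ?_ (ENNReal.sum_le_tsum s)
  rw [Finset.sum_congr rfl fun i hi => by rw [hs i hi]]
  simp

theorem exists_eSeqNorm_elpNorm_eq_one {ι κ : Type*} {p₀ p₁ q₀ q₁ : ℝ≥0∞}
    (hp₀ : 0 < p₀) (hp : p₀ < p₁) (hq₀ : 0 < q₀) (hq : q₀ < q₁)
    (Z : Submodule ℝ (ι → κ → ℝ))
    (hZ : ∀ x ∈ Z, (eSeqNorm q₀ fun j => elpNorm p₀ (x j)) ≠ ∞) {n : ℕ} (hn1 : 1 ≤ n)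
    (hn : (n : Cardinal) ≤ Module.rank ℝ Z) :
    ∃ x ∈ Z, (eSeqNorm q₀ fun j => elpNorm p₀ (x j)) = 1 ∧
      (eSeqNorm q₁ fun j => elpNorm p₁ (x j)) ≤
        (n : ℝ≥0∞) ^ (-(min p₀.toReal⁻¹ q₀.toReal⁻¹ * (1 - (max (q₀ / q₁) (p₀ / p₁)).toReal))) := by
  have hp₁ := (hp₀.trans hp).ne'
  have hq₁ := (hq₀.trans hq).ne'
  have hmax : max (q₀ / q₁) (p₀ / p₁) ≤ 1 :=
    max_le (ENNReal.div_le_of_le_mul (by simpa using hq.le))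
      (ENNReal.div_le_of_le_mul (by simpa using hp.le))
  have htop : max (q₀ / q₁) (p₀ / p₁) ≠ ∞ := (hmax.trans_lt ENNReal.one_lt_top).ne
  set θ := (max (q₀ / q₁) (p₀ / p₁)).toReal with hθ
  have hθ0 : 0 ≤ θ := ENNReal.toReal_nonneg
  have hθ1 : θ ≤ 1 := ENNReal.toReal_mono ENNReal.one_ne_top hmax
  obtain ⟨x, hxZ, hx1, s, hcard, hs⟩ :=
    exists_bounded_of_le_rank hp₀.ne' hp.ne_top hq₀.ne' hq.ne_top Z hZ hn
  have hupper := eSeqNorm_elpNorm_le_rpow hp₀.ne' hp.ne_top hp₁ hq₀.ne' hq.ne_top hq₁ hθ0 hθ1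
    (ENNReal.toReal_mono htop (le_max_right _ _)) (ENNReal.toReal_mono htop (le_max_left _ _))
    x hx1
  have hlower := rpow_le_eSeqNorm_elpNorm hp₀.ne' hp.ne_top hq₀.ne' hq.ne_top x s hs
  set N := eSeqNorm q₀ fun j => elpNorm p₀ (x j) with hN
  set m := min p₀.toReal⁻¹ q₀.toReal⁻¹ with hm
  have hm0 : 0 ≤ m := by positivity
  have hNtop : N ≠ ∞ := hZ x hxZ
  have hnN : (n : ℝ≥0∞) ^ m ≤ N :=
    (ENNReal.rpow_le_rpow (by exact_mod_cast hcard) hm0).trans hlower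
  have hN0 : N ≠ 0 := by
    have : (1 : ℝ≥0∞) ≤ (n : ℝ≥0∞) ^ m := by
      simpa using ENNReal.rpow_le_rpow (x := 1) (y := n) (by exact_mod_cast hn1) hm0
    exact (one_pos.trans_le (this.trans hnN)).ne'
  have hc : ENNReal.ofReal |N.toReal⁻¹| = N⁻¹ := by
    rw [abs_of_nonneg (by positivity), ENNReal.ofReal_inv_of_pos (ENNReal.toReal_pos hN0 hNtop),
      ENNReal.ofReal_toReal hNtop]
  refine ⟨N.toReal⁻¹ • x, Z.smul_mem _ hxZ, ?_, ?_⟩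
  · rw [eSeqNorm_elpNorm_smul hp₀.ne' hq₀.ne', hc, ENNReal.inv_mul_cancel hN0 hNtop]
  · rw [eSeqNorm_elpNorm_smul hp₁ hq₁, hc]
    calc N⁻¹ * _ ≤ N⁻¹ * N ^ θ := by gcongr
      _ = (N ^ (1 - θ))⁻¹ := by
        rw [← ENNReal.rpow_neg_one, ← ENNReal.rpow_add _ _ hN0 hNtop, ← ENNReal.rpow_neg]
        congr 1
        ring
      _ ≤ (((n : ℝ≥0∞) ^ m) ^ (1 - θ))⁻¹ := by
        gcongr
      _ = _ := by rw [← ENNReal.rpow_mul, ← ENNReal.rpow_neg]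

theorem exists_natCast_rpow_neg_le {α : ℝ} (hα : 0 < α) {ε : ℝ} (hε : 0 < ε) :
    ∃ n : ℕ, 1 ≤ n ∧ (n : ℝ≥0∞) ^ (-α) ≤ ENNReal.ofReal ε := by
  have h := (tendsto_rpow_neg_atTop hα).comp tendsto_natCast_atTop_atTop
  obtain ⟨n, hn, hn1⟩ := ((h.eventually (ge_mem_nhds hε)).and
    (Filter.eventually_ge_atTop 1)).exists
  refine ⟨n, hn1, ?_⟩
  rw [← ENNReal.ofReal_natCast, ENNReal.ofReal_rpow_of_pos (by exact_mod_cast hn1)]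
  exact ENNReal.ofReal_le_ofReal hn

theorem statement5 (p₀ p₁ q₀ q₁ : ℝ≥0∞)
    (hp₀ : 0 < p₀) (hp : p₀ < p₁) (hq₀ : 0 < q₀) (hq : q₀ < q₁) :
    (∀ n : ℕ, 1 ≤ n →
      bernstein
        (fun x : ℕ → ℕ → ℝ => eSeqNorm q₀ fun j => elpNorm p₀ (x j))
        (fun x : ℕ → ℕ → ℝ => eSeqNorm q₁ fun j => elpNorm p₁ (x j))
        LinearMap.id n
      ≤ (n : ℝ≥0∞) ^ (-(min p₀.toReal⁻¹ q₀.toReal⁻¹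
            * (1 - (max (q₀ / q₁) (p₀ / p₁)).toReal))))
    ∧ FinStrictlySingular
        (fun x : ℕ → ℕ → ℝ => eSeqNorm q₀ fun j => elpNorm p₀ (x j))
        (fun x : ℕ → ℕ → ℝ => eSeqNorm q₁ fun j => elpNorm p₁ (x j))
        LinearMap.id := by
  constructor
  · intro n hn
    refine iSup_le fun Z => ?_
    obtain ⟨x, hxZ, hx1, hx⟩ :=
      exists_eSeqNorm_elpNorm_eq_one hp₀ hp hq₀ hq Z.1 Z.2.1 hn Z.2.2
    exact iInf_le_of_le ⟨x, hxZ, hx1⟩ hx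
  · intro ε hε
    have hpos : 0 < min p₀.toReal⁻¹ q₀.toReal⁻¹ * (1 - (max (q₀ / q₁) (p₀ / p₁)).toReal) := by
      have hp0 := ENNReal.toReal_pos hp₀.ne' hp.ne_top
      have hq0 := ENNReal.toReal_pos hq₀.ne' hq.ne_top
      have hlt : max (q₀ / q₁) (p₀ / p₁) < 1 :=
        max_lt (ENNReal.div_lt_of_lt_mul (by simpa using hq))
          (ENNReal.div_lt_of_lt_mul (by simpa using hp))
      have := (ENNReal.toReal_lt_toReal hlt.ne_top ENNReal.one_ne_top).2 hlt
      rw [ENNReal.toReal_one] at this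
      exact mul_pos (by positivity) (by linarith)
    obtain ⟨n, hn1, hn⟩ := exists_natCast_rpow_neg_le hpos hε
    refine ⟨n, fun Z hZ hrank => ?_⟩
    obtain ⟨x, hxZ, hx1, hx⟩ := exists_eSeqNorm_elpNorm_eq_one hp₀ hp hq₀ hq Z hZ hn1 hrank
    exact ⟨x, hxZ, hx1, hx.trans hn⟩

end Stmt5
end

section
/- Let 0 < q_0 < q_1 ≤ ∞ and 0 < p ≤ ∞, and let (m_j)_{j=0}^∞ be an arbitrary sequence of positive integers. Then the natural embedding ℓ^{q_0}((ℓ^p{1,…,m_j})_{j≥0}) ↪ ℓ^{q_1}((ℓ^p{1,…,m_j})_{j≥0}) is strictly singular. -/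
/-!
STATEMENT 8: Let 0 < q₀ < q₁ ≤ ∞, 0 < p ≤ ∞, and let (m_j)_j be an arbitrary
sequence of positive integers.  Then the natural embedding
ℓ^{q₀}((ℓ^p{1,…,m_j})_j) ↪ ℓ^{q₁}((ℓ^p{1,…,m_j})_j) is strictly singular.
-/

open scoped ENNReal

namespace Stmt8

/-- The `ℓ^q`-norm of a family of extended-nonnegative numbers. -/
noncomputable def eSeqNorm {ι : Type*} (q : ℝ≥0∞) (f : ι → ℝ≥0∞) : ℝ≥0∞ :=
  if q = ∞ then ⨆ i, f i else (∑' i, f i ^ q.toReal) ^ (1 / q.toReal)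

/-- The scalar `ℓ^p`-(quasi-)norm of a (finite or infinite) real sequence. -/
noncomputable def elpNorm {ι : Type*} (p : ℝ≥0∞) (a : ι → ℝ) : ℝ≥0∞ :=
  eSeqNorm p fun i => ENNReal.ofReal |a i|

/-- `T` is strictly singular w.r.t. the (extended-valued) norms `M₀`, `M₁`. -/
def StrictlySingular {V₀ V₁ : Type*} [AddCommGroup V₀] [Module ℝ V₀]
    [AddCommGroup V₁] [Module ℝ V₁]
    (M₀ : V₀ → ℝ≥0∞) (M₁ : V₁ → ℝ≥0∞) (T : V₀ →ₗ[ℝ] V₁) : Prop :=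
  ∀ Z : Submodule ℝ V₀, (∀ x ∈ Z, M₀ x ≠ ∞) → ¬ FiniteDimensional ℝ Z →
    ∀ ε : ℝ, 0 < ε → ∃ x ∈ Z, M₀ x = 1 ∧ M₁ (T x) < ENNReal.ofReal ε

theorem add_rpow_le_two_rpow_mul {r : ℝ} (hr : 0 ≤ r) (x y : ℝ≥0∞) :
    (x + y) ^ r ≤ 2 ^ r * (x ^ r + y ^ r) := by
  wlog h : x ≤ y generalizing x y
  · rw [add_comm x y, add_comm (x ^ r)]
    exact this y x (le_of_not_ge h)
  calc (x + y) ^ r ≤ (2 * y) ^ r := by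
        gcongr
        rw [two_mul]
        gcongr
    _ = 2 ^ r * y ^ r := ENNReal.mul_rpow_of_nonneg _ _ hr
    _ ≤ _ := by
        gcongr
        exact le_add_self

section eSeqNorm

variable {ι : Type*} {q : ℝ≥0∞}

theorem eSeqNorm_top (f : ι → ℝ≥0∞) : eSeqNorm ∞ f = ⨆ i, f i := if_pos rfl

theorem eSeqNorm_of_ne_top (hq : q ≠ ∞) (f : ι → ℝ≥0∞) :
    eSeqNorm q f = (∑' i, f i ^ q.toReal) ^ (1 / q.toReal) := if_neg hq

theorem eSeqNorm_const_mul (hq : q ≠ 0) (c : ℝ≥0∞) (f : ι → ℝ≥0∞) :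
    eSeqNorm q (fun i => c * f i) = c * eSeqNorm q f := by
  unfold eSeqNorm
  split_ifs with h
  · exact ENNReal.mul_iSup _ _ |>.symm
  · have hpos : 0 < q.toReal := ENNReal.toReal_pos hq h
    simp_rw [ENNReal.mul_rpow_of_nonneg _ _ hpos.le, ENNReal.tsum_mul_left]
    rw [ENNReal.mul_rpow_of_nonneg _ _ (by positivity), one_div, ENNReal.rpow_rpow_inv hpos.ne']

theorem eSeqNorm_eq_zero (hq : q ≠ 0) {f : ι → ℝ≥0∞} : eSeqNorm q f = 0 ↔ ∀ i, f i = 0 := by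
  unfold eSeqNorm
  split_ifs with h
  · simp
  · have hpos : 0 < q.toReal := ENNReal.toReal_pos hq h
    rw [ENNReal.rpow_eq_zero_iff_of_pos (by positivity), ENNReal.tsum_eq_zero]
    simp_rw [ENNReal.rpow_eq_zero_iff_of_pos hpos]

theorem eSeqNorm_mono {f g : ι → ℝ≥0∞} (h : ∀ i, f i ≤ g i) :
    eSeqNorm q f ≤ eSeqNorm q g := by
  unfold eSeqNorm
  split_ifs
  · exact iSup_mono h
  · gcongr with i
    exact h i

theorem eSeqNorm_add_le (hq : q ≠ 0) (f g : ι → ℝ≥0∞) :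
    eSeqNorm q (fun i => f i + g i) ≤
      2 * 2 ^ (1 / q.toReal) * (eSeqNorm q f + eSeqNorm q g) := by
  by_cases h : q = ∞
  · subst h
    simp only [eSeqNorm_top, ENNReal.toReal_top, div_zero, ENNReal.rpow_zero, mul_one]
    exact (iSup_le fun i => add_le_add (le_iSup f i) (le_iSup g i)).trans
      (le_mul_of_one_le_left' one_le_two)
  · have hpos : 0 < q.toReal := ENNReal.toReal_pos hq h
    simp only [eSeqNorm_of_ne_top h]
    set r := q.toReal
    have hr : 0 ≤ 1 / r := by positivity
    calc (∑' i, (f i + g i) ^ r) ^ (1 / r)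
        ≤ (∑' i, 2 ^ r * (f i ^ r + g i ^ r)) ^ (1 / r) := by
          gcongr with i
          exact add_rpow_le_two_rpow_mul hpos.le _ _
      _ = 2 * (∑' i, f i ^ r + ∑' i, g i ^ r) ^ (1 / r) := by
          rw [ENNReal.tsum_mul_left, ENNReal.tsum_add, ENNReal.mul_rpow_of_nonneg _ _ hr,
            one_div, ENNReal.rpow_rpow_inv hpos.ne']
      _ ≤ _ := by
          rw [mul_assoc]
          gcongr
          exact add_rpow_le_two_rpow_mul hr _ _

end eSeqNorm

section elpNorm

variable {ι : Type*} {p : ℝ≥0∞}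

theorem elpNorm_smul (hp : p ≠ 0) (c : ℝ) (a : ι → ℝ) :
    elpNorm p (c • a) = ENNReal.ofReal |c| * elpNorm p a := by
  simp only [elpNorm, ← eSeqNorm_const_mul hp, Pi.smul_apply, smul_eq_mul, abs_mul,
    ENNReal.ofReal_mul (abs_nonneg c)]

theorem elpNorm_eq_zero (hp : p ≠ 0) {a : ι → ℝ} : elpNorm p a = 0 ↔ a = 0 := by
  rw [elpNorm, eSeqNorm_eq_zero hp, funext_iff]
  simp

theorem elpNorm_neg (a : ι → ℝ) : elpNorm p (-a) = elpNorm p a := by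
  simp [elpNorm]

theorem elpNorm_add_le (hp : p ≠ 0) (a b : ι → ℝ) :
    elpNorm p (a + b) ≤ 2 * 2 ^ (1 / p.toReal) * (elpNorm p a + elpNorm p b) := by
  refine (eSeqNorm_mono fun i => ?_).trans (eSeqNorm_add_le hp _ _)
  rw [← ENNReal.ofReal_add (abs_nonneg _) (abs_nonneg _)]
  exact ENNReal.ofReal_le_ofReal (abs_add_le _ _)

end elpNorm

theorem exists_elpNorm_rpow_add_le {p : ℝ≥0∞} (hp : p ≠ 0) {r : ℝ} (hr : 0 ≤ r) :
    ∃ K : ℝ≥0∞, 1 ≤ K ∧ K ≠ ∞ ∧ ∀ (n : ℕ) (a b : Fin n → ℝ),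
      elpNorm p (a + b) ^ r ≤ K * (elpNorm p a ^ r + elpNorm p b ^ r) := by
  have hs : 0 ≤ 1 / p.toReal := by positivity
  refine ⟨(2 * 2 ^ (1 / p.toReal)) ^ r * 2 ^ r, ?_, by finiteness, fun n a b => ?_⟩
  · have h {x : ℝ≥0∞} {s : ℝ} (hx : 1 ≤ x) (hs : 0 ≤ s) : 1 ≤ x ^ s :=
      (ENNReal.one_rpow s).symm.trans_le (ENNReal.rpow_le_rpow hx hs)
    exact one_le_mul (h (one_le_mul one_le_two (h one_le_two hs)) hr) (h one_le_two hr)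
  · calc elpNorm p (a + b) ^ r
        ≤ (2 * 2 ^ (1 / p.toReal) * (elpNorm p a + elpNorm p b)) ^ r := by
          gcongr
          exact elpNorm_add_le hp a b
      _ ≤ _ := by
          rw [ENNReal.mul_rpow_of_nonneg _ _ hr, mul_assoc]
          gcongr
          exact add_rpow_le_two_rpow_mul hr _ _

/-- An infinite-dimensional space of sequences contains nonzero sequences starting arbitrarily
late. -/
theorem exists_mem_ne_zero_forall_lt_eq_zero {V : ℕ → Type*} [∀ j, AddCommGroup (V j)]
    [∀ j, Module ℝ (V j)] [∀ j, FiniteDimensional ℝ (V j)] {Z : Submodule ℝ (∀ j, V j)}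
    (hZ : ¬ FiniteDimensional ℝ Z) (n : ℕ) :
    ∃ x ∈ Z, x ≠ 0 ∧ ∀ j < n, x j = 0 := by
  let T : Z →ₗ[ℝ] (∀ j : Fin n, V j) :=
    (LinearMap.pi fun j : Fin n => LinearMap.proj (j : ℕ)) ∘ₗ Z.subtype
  have hT : ¬ Function.Injective T := fun h => hZ (Module.Finite.of_injective T h)
  rw [← LinearMap.ker_eq_bot, Submodule.eq_bot_iff] at hT
  push Not at hT
  obtain ⟨x, hx, hx0⟩ := hT
  exact ⟨x, x.2, by simpa using hx0, fun j hj => congrFun hx ⟨j, hj⟩⟩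

section blocks

variable {m : ℕ → ℕ} {p : ℝ≥0∞} {r : ℝ}

theorem tsum_elpNorm_rpow_smul (hp : p ≠ 0) (hr : 0 ≤ r) (c : ℝ) (x : ∀ j, Fin (m j) → ℝ) :
    ∑' j, elpNorm p ((c • x) j) ^ r = ENNReal.ofReal |c| ^ r * ∑' j, elpNorm p (x j) ^ r := by
  simp_rw [Pi.smul_apply, elpNorm_smul hp, ENNReal.mul_rpow_of_nonneg _ _ hr,
    ENNReal.tsum_mul_left]

theorem exists_smul_tsum_elpNorm_rpow_eq_one (hp : p ≠ 0) (hr : 0 < r)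
    {x : ∀ j, Fin (m j) → ℝ} (h0 : ∑' j, elpNorm p (x j) ^ r ≠ 0)
    (h1 : ∑' j, elpNorm p (x j) ^ r ≠ ∞) :
    ∃ c : ℝ, ENNReal.ofReal |c| ^ r = (∑' j, elpNorm p (x j) ^ r)⁻¹ ∧
      ∑' j, elpNorm p ((c • x) j) ^ r = 1 := by
  set G := ∑' j, elpNorm p (x j) ^ r
  have hfin : (G⁻¹) ^ r⁻¹ ≠ ∞ :=
    ENNReal.rpow_ne_top_of_nonneg (by positivity) (ENNReal.inv_ne_top.2 h0)
  have hc : ENNReal.ofReal |((G⁻¹) ^ r⁻¹).toReal| ^ r = G⁻¹ := by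
    rw [abs_of_nonneg ENNReal.toReal_nonneg, ENNReal.ofReal_toReal hfin,
      ENNReal.rpow_inv_rpow hr.ne']
  exact ⟨_, hc, by rw [tsum_elpNorm_rpow_smul hp hr.le, hc, ENNReal.inv_mul_cancel h0 h1]⟩

variable {Z : Submodule ℝ (∀ j, Fin (m j) → ℝ)}

theorem exists_mem_tsum_eq_one_forall_lt_eq_zero (hp : p ≠ 0) (hr : 0 < r)
    (hfin : ∀ x ∈ Z, ∑' j, elpNorm p (x j) ^ r ≠ ∞) (hZ : ¬ FiniteDimensional ℝ Z) (n : ℕ) :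
    ∃ x ∈ Z, ∑' j, elpNorm p (x j) ^ r = 1 ∧ ∀ j < n, x j = 0 := by
  obtain ⟨x, hxZ, hx0, hx⟩ := exists_mem_ne_zero_forall_lt_eq_zero hZ n
  have h0 : ∑' j, elpNorm p (x j) ^ r ≠ 0 := by
    contrapose! hx0
    rw [ENNReal.tsum_eq_zero] at hx0
    funext j
    exact (elpNorm_eq_zero hp).1 ((ENNReal.rpow_eq_zero_iff_of_pos hr).1 (hx0 j))
  obtain ⟨c, -, hc⟩ := exists_smul_tsum_elpNorm_rpow_eq_one hp hr h0 (hfin x hxZ)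
  exact ⟨c • x, Z.smul_mem c hxZ, hc, fun j hj => by simp [hx j hj]⟩

/-- Gliding hump: the norm can be made arbitrarily large while the blocks stay bounded. -/
theorem exists_forall_exists_mem_le_tsum (hp : p ≠ 0) (hr : 0 < r)
    (hfin : ∀ x ∈ Z, ∑' j, elpNorm p (x j) ^ r ≠ ∞) (hZ : ¬ FiniteDimensional ℝ Z) :
    ∃ B c : ℝ≥0∞, B ≠ ∞ ∧ c ≠ 0 ∧ ∀ N : ℕ, ∃ x ∈ Z,
      N * c ≤ ∑' j, elpNorm p (x j) ^ r ∧ ∀ j, elpNorm p (x j) ^ r ≤ B := by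
  obtain ⟨K, hK1, hK, hadd⟩ := exists_elpNorm_rpow_add_le hp hr.le
  have hK0 : K ≠ 0 := (one_pos.trans_le hK1).ne'
  have h3K : 3 * K ≠ 0 := mul_ne_zero three_ne_zero hK0
  have h3K' : 3 * K ≠ ∞ := ENNReal.mul_ne_top (by finiteness) hK
  set c := (3 * K)⁻¹ with hcdef
  have hc0 : c ≠ 0 := ENNReal.inv_ne_zero.2 h3K'
  have hctop : c ≠ ∞ := ENNReal.inv_ne_top.2 h3K
  have hc1 : c ≤ 1 := ENNReal.inv_le_one.2 (one_le_mul (by norm_num) hK1)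
  have hcK : K * (3 * c) = 1 := by
    rw [← mul_assoc, mul_comm K, ENNReal.mul_inv_cancel h3K h3K']
  refine ⟨K * 2, c, ENNReal.mul_ne_top hK (by finiteness), hc0, fun N => ?_⟩
  induction N with
  | zero => exact ⟨0, Z.zero_mem, by simp, fun j => by
      simp [(elpNorm_eq_zero hp).2 (rfl : (0 : Fin (m j) → ℝ) = 0), ENNReal.zero_rpow_of_pos hr]⟩
  | succ N ih =>
    obtain ⟨S, hSZ, hSN, hSB⟩ := ih
    obtain ⟨n, hn⟩ := ((ENNReal.tendsto_sum_nat_add _ (hfin S hSZ)).eventually_le_const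
      (pos_iff_ne_zero.2 hc0)).exists
    obtain ⟨x, hxZ, hx1, hxn⟩ := exists_mem_tsum_eq_one_forall_lt_eq_zero hp hr hfin hZ n
    have split (y : ∀ j, Fin (m j) → ℝ) := ENNReal.summable.sum_add_tsum_nat_add'
      (f := fun j => elpNorm p (y j) ^ r) (k := n)
    have hlow : ∀ j < n, (S + x) j = S j := fun j hj => by simp [hxn j hj]
    refine ⟨S + x, Z.add_mem hSZ hxZ, ?_, fun j => ?_⟩
    · have hx_tail : ∑' k, elpNorm p (x (k + n)) ^ r = 1 := by
        rw [← hx1, ← split x, Finset.sum_eq_zero, zero_add]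
        intro j hj
        rw [hxn j (Finset.mem_range.1 hj), (elpNorm_eq_zero hp).2 rfl,
          ENNReal.zero_rpow_of_pos hr]
      have htail : 1 ≤ K * (∑' k, elpNorm p ((S + x) (k + n)) ^ r +
          ∑' k, elpNorm p (S (k + n)) ^ r) := by
        rw [← hx_tail, ← ENNReal.tsum_add, ← ENNReal.tsum_mul_left]
        refine ENNReal.tsum_le_tsum fun k => ?_
        simpa [elpNorm_neg] using hadd _ ((S + x) (k + n)) (-S (k + n))
      rw [← hcK, ENNReal.mul_le_mul_iff_right hK0 hK] at htail
      have h2c : c + c ≤ ∑' k, elpNorm p ((S + x) (k + n)) ^ r := by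
        refine (ENNReal.add_le_add_iff_right hctop).1 ((le_of_eq ?_).trans
          (htail.trans (add_le_add_right hn _)))
        ring
      rw [← split S] at hSN
      rw [← split (S + x), Finset.sum_congr rfl fun j hj => by
        rw [hlow j (Finset.mem_range.1 hj)]]
      calc ((N + 1 : ℕ) : ℝ≥0∞) * c = N * c + c := by push_cast; ring
        _ ≤ (∑ j ∈ Finset.range n, elpNorm p (S j) ^ r + c) + c := by
            gcongr
            exact hSN.trans (add_le_add_right hn _)
        _ ≤ _ := by
            rw [add_assoc]
            gcongr
    · rcases lt_or_ge j n with hj | hj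
      · rw [hlow j hj]
        exact hSB j
      · refine (hadd _ (S j) (x j)).trans ?_
        rw [← one_add_one_eq_two]
        gcongr
        · obtain ⟨k, rfl⟩ := Nat.exists_eq_add_of_le' hj
          exact (ENNReal.le_tsum (f := fun k => elpNorm p (S (k + n)) ^ r) k).trans
            (hn.trans hc1)
        · exact hx1 ▸ ENNReal.le_tsum (f := fun j => elpNorm p (x j) ^ r) j

theorem exists_mem_tsum_eq_one_forall_le (hp : p ≠ 0) (hr : 0 < r)
    (hfin : ∀ x ∈ Z, ∑' j, elpNorm p (x j) ^ r ≠ ∞) (hZ : ¬ FiniteDimensional ℝ Z)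
    {δ : ℝ≥0∞} (hδ : δ ≠ 0) :
    ∃ x ∈ Z, ∑' j, elpNorm p (x j) ^ r = 1 ∧ ∀ j, elpNorm p (x j) ^ r ≤ δ := by
  obtain ⟨B, c, hB, hc, h⟩ := exists_forall_exists_mem_le_tsum hp hr hfin hZ
  obtain ⟨N, hN⟩ := ENNReal.exists_nat_mul_gt (mul_ne_zero hδ hc) hB
  obtain ⟨x, hxZ, hxN, hxB⟩ := h N
  have hlt : B < δ * ∑' j, elpNorm p (x j) ^ r := hN.trans_le <| by
    rw [mul_left_comm]
    gcongr
  have h0 : ∑' j, elpNorm p (x j) ^ r ≠ 0 := fun h0 => by simp [h0] at hlt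
  obtain ⟨a, ha, ha1⟩ := exists_smul_tsum_elpNorm_rpow_eq_one hp hr h0 (hfin x hxZ)
  refine ⟨a • x, Z.smul_mem a hxZ, ha1, fun j => ?_⟩
  rw [Pi.smul_apply, elpNorm_smul hp, ENNReal.mul_rpow_of_nonneg _ _ hr.le, ha, mul_comm,
    ← div_eq_mul_inv]
  exact ENNReal.div_le_of_le_mul ((hxB j).trans hlt.le)

end blocks

/-- Interpolation between `ℓ^q₀` and `ℓ^∞`. -/
theorem exists_eSeqNorm_lt {ι : Type*} {q₀ q₁ : ℝ≥0∞} (hq₀ : 0 < q₀) (hq : q₀ < q₁) {ε : ℝ≥0∞}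
    (hε : ε ≠ 0) :
    ∃ δ : ℝ≥0∞, δ ≠ 0 ∧ ∀ f : ι → ℝ≥0∞, ∑' i, f i ^ q₀.toReal = 1 →
      (∀ i, f i ^ q₀.toReal ≤ δ) → eSeqNorm q₁ f < ε := by
  have hr : 0 < q₀.toReal := ENNReal.toReal_pos hq₀.ne' hq.ne_top
  obtain ⟨η, hη0, hηε⟩ := exists_between (pos_iff_ne_zero.2 hε)
  have hηtop : η ≠ ∞ := hηε.ne_top
  by_cases h : q₁ = ∞
  · subst h
    refine ⟨η ^ q₀.toReal, (ENNReal.rpow_pos hη0 hηtop).ne', fun f _ hf => ?_⟩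
    rw [eSeqNorm_top]
    exact (iSup_le fun i => (ENNReal.rpow_le_rpow_iff hr).1 (hf i)).trans_lt hηε
  · set r := q₀.toReal
    set s := q₁.toReal with hs_def
    have hrs : r < s := (ENNReal.toReal_lt_toReal hq.ne_top h).2 hq
    have hs : 0 < s := hr.trans hrs
    have ht : 0 < s / r - 1 := by
      rw [sub_pos, one_lt_div hr]
      exact hrs
    refine ⟨(η ^ s) ^ (s / r - 1)⁻¹,
      (ENNReal.rpow_pos (ENNReal.rpow_pos hη0 hηtop) (by finiteness)).ne', fun f hf1 hf => ?_⟩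
    rw [eSeqNorm_of_ne_top h, ← hs_def]
    refine lt_of_le_of_lt ?_ hηε
    rw [one_div, ENNReal.rpow_inv_le_iff hs]
    calc ∑' i, f i ^ s ≤ ∑' i, η ^ s * f i ^ r := by
          refine ENNReal.tsum_le_tsum fun i => ?_
          calc f i ^ s = (f i ^ r) ^ (s / r - 1) * f i ^ r := by
                rw [← ENNReal.rpow_mul, ← ENNReal.rpow_add_of_nonneg _ _ (by positivity) hr.le]
                congr 1
                field_simp
                ring
            _ ≤ _ := by
                gcongr
                exact (ENNReal.rpow_le_rpow (hf i) ht.le).trans_eq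
                  (ENNReal.rpow_inv_rpow ht.ne' _)
      _ = η ^ s := by rw [ENNReal.tsum_mul_left, hf1, mul_one]

theorem statement8 (p q₀ q₁ : ℝ≥0∞) (hp : 0 < p) (hq₀ : 0 < q₀) (hq : q₀ < q₁)
    (m : ℕ → ℕ) (hm : ∀ j, 0 < m j) :
    StrictlySingular
      (fun x : ∀ j : ℕ, Fin (m j) → ℝ => eSeqNorm q₀ fun j => elpNorm p (x j))
      (fun x : ∀ j : ℕ, Fin (m j) → ℝ => eSeqNorm q₁ fun j => elpNorm p (x j))
      LinearMap.id := by
  intro Z hfin hZ ε hε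
  have hr : 0 < q₀.toReal := ENNReal.toReal_pos hq₀.ne' hq.ne_top
  simp only [eSeqNorm_of_ne_top hq.ne_top, LinearMap.id_coe, id_eq] at hfin ⊢
  obtain ⟨δ, hδ, hlt⟩ := exists_eSeqNorm_lt (ι := ℕ) hq₀ hq (ENNReal.ofReal_pos.2 hε).ne'
  have hfin' : ∀ x ∈ Z, ∑' j, elpNorm p (x j) ^ q₀.toReal ≠ ∞ := fun x hx h =>
    hfin x hx (by rw [h, ENNReal.top_rpow_of_pos (by positivity)])
  obtain ⟨x, hxZ, hx1, hxδ⟩ := exists_mem_tsum_eq_one_forall_le hp.ne' hr hfin' hZ hδ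
  exact ⟨x, hxZ, by rw [hx1, ENNReal.one_rpow], hlt _ hx1 hxδ⟩

end Stmt8
end
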